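/- Let m ≥ 1, let f : ℂ^m → ℂ be a nonconstant entire function, let u ∈ ℂ^m be a unit vector, and let k, n be positive integers with n ≥ k + 2 such that ∂_u^k(f^n) is not identically zero. If f^n and ∂_u^k(f^n) share the value 1 IM, then there exists c ∈ ℂ \ {0} with (c/n)^k = 1 such that f = c·∂_u f identically on ℂ^m. (Paper's Theorem 2.2.) -/

import Mathlib

/-- The directional derivative of `f : ℂ^m → ℂ` along the direction `u`. -/
noncomputable def dirDeriv {m : ℕ} (u : Fin m → ℂ) (f : (Fin m → ℂ) → ℂ) :
    (Fin m → ℂ) → ℂ :=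
  fun z => fderiv ℂ f z u

section

open Complex Metric Filter Topology ValueDistribution Real

lemma Complex.normSq_blaschke (R : ℝ) (a z : ℂ) :
    normSq (R ^ 2 - (starRingEnd ℂ) a * z) - R ^ 2 * normSq (z - a)
      = (R ^ 2 - normSq z) * (R ^ 2 - normSq a) := by
  simp only [normSq_apply, sub_re, sub_im, mul_re, mul_im, conj_re, conj_im, ← ofReal_pow,
    ofReal_re, ofReal_im]
  ring

lemma Complex.norm_sub_le_norm_blaschke {R : ℝ} (hR : 0 < R) {a z : ℂ} (ha : ‖a‖ ≤ R)
    (hz : ‖z‖ ≤ R) : ‖z - a‖ ≤ ‖(R ^ 2 - (starRingEnd ℂ) a * z) / R‖ := by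
  rw [norm_div, norm_real, Real.norm_of_nonneg hR.le, le_div_iff₀ hR]
  have h := normSq_blaschke R a z
  rw [normSq_eq_norm_sq, normSq_eq_norm_sq, normSq_eq_norm_sq, normSq_eq_norm_sq] at h
  refine le_of_sq_le_sq ?_ (norm_nonneg _)
  have h1 : 0 ≤ R ^ 2 - ‖z‖ ^ 2 := by nlinarith [norm_nonneg z]
  have h2 : 0 ≤ R ^ 2 - ‖a‖ ^ 2 := by nlinarith [norm_nonneg a]
  nlinarith [mul_nonneg h1 h2]

lemma Complex.norm_blaschke_of_norm_eq {R : ℝ} (hR : 0 < R) {a z : ℂ}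
    (hz : ‖z‖ = R) : ‖(R ^ 2 - (starRingEnd ℂ) a * z) / R‖ = ‖z - a‖ := by
  rw [norm_div, norm_real, Real.norm_of_nonneg hR.le, div_eq_iff hR.ne']
  have h := normSq_blaschke R a z
  rw [normSq_eq_norm_sq, normSq_eq_norm_sq, normSq_eq_norm_sq, normSq_eq_norm_sq, hz] at h
  rw [← sq_eq_sq₀ (norm_nonneg _) (by positivity)]
  nlinarith

/-- The zeros `a` of `F = G * ∏ (z - a i)` reflected in the circle of radius `R`. -/
noncomputable def zeroReflection {N : ℕ} (G : ℂ → ℂ) (a : Fin N → ℂ) (R : ℝ) (z : ℂ) : ℂ :=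
  G z * ∏ i, ((R ^ 2 - (starRingEnd ℂ) (a i) * z) / R)

section zeroReflection
variable {N : ℕ} {F G : ℂ → ℂ} {a : Fin N → ℂ} {R R' M : ℝ}

lemma differentiable_zeroReflection (hG : Differentiable ℂ G) :
    Differentiable ℂ (zeroReflection G a R) := by
  unfold zeroReflection
  fun_prop

lemma norm_zeroReflection_of_norm_eq (hF : ∀ z, F z = G z * ∏ i, (z - a i)) (hR : 0 < R) {z : ℂ}
    (hz : ‖z‖ = R) : ‖zeroReflection G a R z‖ = ‖F z‖ := by
  rw [zeroReflection, hF, norm_mul, norm_mul, norm_prod, norm_prod]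
  simp_rw [norm_blaschke_of_norm_eq hR hz]

lemma norm_le_norm_zeroReflection (hF : ∀ z, F z = G z * ∏ i, (z - a i)) (hR : 0 < R)
    (ha : ∀ i, ‖a i‖ ≤ R) {z : ℂ} (hz : ‖z‖ ≤ R) : ‖F z‖ ≤ ‖zeroReflection G a R z‖ := by
  rw [zeroReflection, hF, norm_mul, norm_mul, norm_prod, norm_prod]
  gcongr with i
  exact norm_sub_le_norm_blaschke hR (ha i) hz

lemma norm_zeroReflection_le (hG : Differentiable ℂ G) (hF : ∀ z, F z = G z * ∏ i, (z - a i))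
    (hR : 0 < R) (hM : ∀ z, ‖z‖ = R → ‖F z‖ ≤ M) {z : ℂ} (hz : ‖z‖ ≤ R) :
    ‖zeroReflection G a R z‖ ≤ M := by
  refine norm_le_of_forall_mem_frontier_norm_le (U := ball (0 : ℂ) R) isBounded_ball
    (differentiable_zeroReflection hG).diffContOnCl ?_ (by
      rw [closure_ball _ hR.ne']; simpa using hz)
  intro w hw
  rw [frontier_ball _ hR.ne', mem_sphere_zero_iff_norm] at hw
  rw [norm_zeroReflection_of_norm_eq hF hR hw]
  exact hM w hw

lemma norm_mul_pow_le_norm_zeroReflection_zero (hF : ∀ z, F z = G z * ∏ i, (z - a i))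
    (hR : 0 < R) (hR' : 0 < R') (ha : ∀ i, ‖a i‖ ≤ R') :
    ‖F 0‖ * (R / R') ^ N ≤ ‖zeroReflection G a R 0‖ := by
  have h1 : ∏ i, ‖(0 : ℂ) - a i‖ ≤ R' ^ N := by
    refine (Finset.prod_le_prod (fun _ _ => norm_nonneg _) (g := fun _ => R') ?_).trans ?_
    · intro i _; simpa using ha i
    · simp
  have h2 : ‖zeroReflection G a R 0‖ = ‖G 0‖ * R ^ N := by
    simp [zeroReflection, norm_pow, pow_two, abs_of_pos hR, hR.ne']
  rw [h2, hF, norm_mul, norm_prod, div_pow, mul_assoc]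
  gcongr
  rw [mul_div_assoc', div_le_iff₀ (by positivity), mul_comm]
  gcongr

end zeroReflection

lemma exists_eq_sub_mul {G : ℂ → ℂ} (hG : Differentiable ℂ G) {w : ℂ} (hw : G w = 0) :
    ∃ G' : ℂ → ℂ, Differentiable ℂ G' ∧ ∀ z, G z = G' z * (z - w) := by
  refine ⟨dslope G w, ?_, fun z => ?_⟩
  · rw [← differentiableOn_univ] at hG ⊢
    exact (differentiableOn_dslope univ_mem).2 hG
  · have := sub_smul_dslope G w z
    rw [hw, sub_zero, smul_eq_mul] at this
    rw [← this, mul_comm]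

/-- Division by the finitely many zeros in a closed disk. -/
lemma exists_zero_factorization {F : ℂ → ℂ} (hF : Differentiable ℂ F) (h0 : F 0 ≠ 0) {R : ℝ}
    (hR : 0 < R) :
    ∃ (N : ℕ) (G : ℂ → ℂ) (a : Fin N → ℂ), Differentiable ℂ G ∧
      (∀ z, F z = G z * ∏ i, (z - a i)) ∧ (∀ i, ‖a i‖ ≤ R) ∧ ∀ z, ‖z‖ ≤ R → G z ≠ 0 := by
  set P : ℕ → Prop := fun N => ∃ (G : ℂ → ℂ) (a : Fin N → ℂ), Differentiable ℂ G ∧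
      (∀ z, F z = G z * ∏ i, (z - a i)) ∧ ∀ i, ‖a i‖ ≤ R with hP
  have hP0 : P 0 := ⟨F, Fin.elim0, hF, by simp, fun i => i.elim0⟩
  obtain ⟨M, hM⟩ := (isCompact_sphere (0 : ℂ) (2 * R)).exists_bound_of_continuousOn
    hF.continuous.continuousOn
  have hbd : ∀ N, P N → ‖F 0‖ * 2 ^ N ≤ M := by
    rintro N ⟨G, a, hG, hFG, ha⟩
    have h1 := norm_mul_pow_le_norm_zeroReflection_zero hFG (by positivity : 0 < 2 * R) hR ha
    have h2 := norm_zeroReflection_le hG hFG (by positivity : 0 < 2 * R)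
      (fun z hz => hM z (by simpa using hz)) (z := 0) (by simpa using hR.le)
    rw [mul_div_assoc, div_self hR.ne', mul_one] at h1
    exact h1.trans h2
  have hbd' : ∃ B : ℕ, ∀ N, P N → N ≤ B := by
    obtain ⟨B, hB⟩ := pow_unbounded_of_one_lt (M / ‖F 0‖) (one_lt_two)
    refine ⟨B, fun N hN => ?_⟩
    by_contra! hlt
    have h1 := hbd N hN
    have h2 : (2 : ℝ) ^ B ≤ 2 ^ N := pow_le_pow_right₀ one_le_two hlt.le
    rw [div_lt_iff₀ (norm_pos_iff.2 h0)] at hB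
    nlinarith [norm_pos_iff.2 h0]
  obtain ⟨B, hB⟩ := hbd'
  classical
  have hspec := Nat.findGreatest_spec (P := P) (Nat.zero_le B) hP0
  obtain ⟨G, a, hG, hFG, ha⟩ := hspec
  refine ⟨_, G, a, hG, hFG, ha, fun w hw hGw => ?_⟩
  obtain ⟨G', hG', hGG'⟩ := exists_eq_sub_mul hG hGw
  have hnext : P (Nat.findGreatest P B + 1) := by
    refine ⟨G', Fin.cons w a, hG', fun z => ?_, fun i => ?_⟩
    · rw [hFG, hGG', Fin.prod_univ_succ]
      simp [mul_assoc]
    · refine Fin.cases ?_ (fun j => ?_) i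
      · simpa using hw
      · simpa using ha j
  exact absurd (Nat.le_findGreatest (hB _ hnext) hnext) (by omega)

lemma eq_mul_exp_of_hasDerivAt_logDeriv {H L : ℂ → ℂ} (hH : Differentiable ℂ H) {R : ℝ}
    (hne : ∀ z ∈ ball (0 : ℂ) R, H z ≠ 0) (hL0 : L 0 = 0)
    (hL : ∀ z ∈ ball (0 : ℂ) R, HasDerivAt L (deriv H z / H z) z) {z : ℂ}
    (hz : z ∈ ball (0 : ℂ) R) : H z = H 0 * cexp (L z) := by
  have hd : ∀ w ∈ ball (0 : ℂ) R, HasDerivAt (fun w => H w * cexp (-L w)) 0 w := by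
    intro w hw
    have := (hH w).hasDerivAt.mul (hL w hw).neg.cexp
    convert! this using 1
    have := hne w hw
    simp
    field_simp
    ring
  have h0 : (0 : ℂ) ∈ ball (0 : ℂ) R := by
    simpa using (norm_nonneg z).trans_lt (mem_ball_zero_iff.1 hz)
  have := (convex_ball (0 : ℂ) R).is_const_of_fderivWithin_eq_zero (𝕜 := ℂ)
    (f := fun w => H w * cexp (-L w))
    (fun w hw => (hd w hw).differentiableAt.differentiableWithinAt)
    (fun w hw => by
      rw [fderivWithin_of_isOpen isOpen_ball hw]
      ext
      simp [(hd w hw).deriv]) hz h0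
  simp only [hL0, neg_zero, Complex.exp_zero, mul_one] at this
  rw [← this, mul_assoc, ← Complex.exp_add]
  simp

lemma re_eq_log_of_eq_mul_exp {x y l : ℂ} (hy : y ≠ 0) (h : x = y * cexp l) :
    l.re = Real.log (‖x‖ / ‖y‖) := by
  rw [h, norm_mul, Complex.norm_exp, mul_div_cancel_left₀ _ (norm_ne_zero_iff.2 hy), Real.log_exp]

/-- The logarithmic derivative of a bounded zero-free function is bounded on smaller disks. -/
lemma norm_logDeriv_le_of_ne_zero {H : ℂ → ℂ} (hH : Differentiable ℂ H) {r δ M A : ℝ}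
    (hr : 0 ≤ r) (hδ : 0 < δ) (hA : 0 < A)
    (hne : ∀ z ∈ ball (0 : ℂ) (r + δ), H z ≠ 0) (hM : ∀ z ∈ ball (0 : ℂ) (r + δ), ‖H z‖ ≤ M)
    (hMA : Real.log (M / ‖H 0‖) ≤ A) {z : ℂ} (hz : ‖z‖ ≤ r) :
    ‖deriv H z / H z‖ ≤ 8 * A * (r + δ) / δ ^ 2 := by
  have h0 : (0 : ℂ) ∈ ball (0 : ℂ) (r + δ) := by simpa using by linarith
  have hd : DifferentiableOn ℂ (fun z => deriv H z / H z) (ball (0 : ℂ) (r + δ)) :=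
    hH.deriv.differentiableOn.div hH.differentiableOn hne
  obtain ⟨L, hL0, hL⟩ := hd.isExactOn_ball.with_val_at 0 0
  have hre : ∀ w ∈ ball (0 : ℂ) (r + δ), (L w).re ≤ A := by
    intro w hw
    rw [re_eq_log_of_eq_mul_exp (hne 0 h0) (eq_mul_exp_of_hasDerivAt_logDeriv hH hne hL0 hL hw)]
    refine le_trans ?_ hMA
    have h1 := norm_pos_iff.2 (hne w hw)
    have h2 := norm_pos_iff.2 (hne 0 h0)
    have h3 := hM w hw
    gcongr
  have hLd : DifferentiableOn ℂ L (ball (0 : ℂ) (r + δ)) :=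
    fun w hw => (hL w hw).differentiableAt.differentiableWithinAt
  have hbound : ∀ w ∈ sphere z (δ / 2), ‖L w‖ ≤ 4 * A * (r + δ) / δ := by
    intro w hw
    have hw' : ‖w‖ ≤ r + δ / 2 := by
      have := norm_le_norm_add_norm_sub' w z
      rw [mem_sphere_iff_norm] at hw
      linarith
    have hwb : w ∈ ball (0 : ℂ) (r + δ) := by rw [mem_ball_zero_iff]; linarith
    refine (borelCaratheodory_zero hA hLd (fun w hw => hre w hw) (by linarith) hwb hL0).trans ?_
    rw [div_le_div_iff₀ (by linarith) hδ]
    have e1 : 2 * A * ‖w‖ * δ ≤ 2 * A * (r + δ) * δ := by gcongr; linarith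
    have e2 : 4 * A * (r + δ) * (δ / 2) ≤ 4 * A * (r + δ) * (r + δ - ‖w‖) := by
      gcongr; linarith
    linarith
  have hzb : z ∈ ball (0 : ℂ) (r + δ) := by rw [mem_ball_zero_iff]; linarith
  have hsub : closedBall z (δ / 2) ⊆ ball (0 : ℂ) (r + δ) := by
    intro w hw
    rw [mem_closedBall_iff_norm] at hw
    have := norm_le_norm_add_norm_sub' w z
    rw [mem_ball_zero_iff]
    linarith
  have := norm_deriv_le_of_forall_mem_sphere_norm_le (by positivity : 0 < δ / 2)
    ((hLd.mono (closure_ball_subset_closedBall.trans hsub)).diffContOnCl) hbound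
  rw [(hL z hzb).deriv] at this
  refine this.trans (le_of_eq ?_)
  field_simp
  ring

lemma log_norm_le_proximity_of_ne_zero {H : ℂ → ℂ} (hH : Differentiable ℂ H) {r R : ℝ}
    (hr : 0 ≤ r) (hrR : r < R) (hne : ∀ z ∈ ball (0 : ℂ) R, H z ≠ 0) {z : ℂ} (hz : ‖z‖ ≤ r) :
    Real.log ‖H z‖ ≤ (R + r) / (R - r) * proximity H ⊤ R := by
  have key : ∀ ρ ∈ Set.Ioo r R, Real.log ‖H z‖ ≤ (ρ + r) / (ρ - r) * proximity H ⊤ ρ := by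
    rintro ρ ⟨h1, h2⟩
    have hzb : z ∈ ball (0 : ℂ) ρ := by rw [mem_ball_zero_iff]; linarith
    have hne' : ∀ w ∈ closedBall (0 : ℂ) ρ, H w ≠ 0 := fun w hw =>
      hne w (closedBall_subset_ball h2 hw)
    have hharm : InnerProductSpace.HarmonicOnNhd (fun w => Real.log ‖H w‖) (closedBall 0 ρ) :=
      fun w hw => (hH.analyticAt w).harmonicAt_log_norm (hne' w hw)
    rw [← hharm.circleAverage_re_herglotzRieszKernel_smul hzb, proximity_top, ← smul_eq_mul,
      ← circleAverage_smul]
    have hcont : ContinuousOn (fun w => Real.log ‖H w‖) (sphere 0 ρ) :=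
      (hH.continuous.norm.continuousOn).log
        fun w hw => norm_ne_zero_iff.2 (hne' w (sphere_subset_closedBall hw))
    have hρ : 0 ≤ ρ := by linarith
    apply circleAverage_mono
    · apply ContinuousOn.circleIntegrable hρ
      refine ContinuousOn.smul (Complex.continuous_re.comp_continuousOn ?_) hcont
      rw [herglotzRieszKernel_fun_def]
      refine ContinuousOn.div (by fun_prop) (by fun_prop) ?_
      intro w hw h
      rw [mem_sphere_zero_iff_norm] at hw
      have : w = z := by linear_combination h
      rw [this] at hw; linarith
    · refine ContinuousOn.circleIntegrable hρ (Continuous.continuousOn ?_)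
      have := hH.continuous
      exact (continuous_posLog.comp this.norm).const_smul _
    · intro w hw
      rw [abs_of_nonneg hρ] at hw
      have a1 := le_re_herglotzRieszKernel hw hzb
      have a2 := re_herglotzRieszKernel_le hw hzb
      rw [sub_zero] at a1 a2
      have a3 : (0 : ℝ) ≤ (ρ - ‖z‖) / (ρ + ‖z‖) := by
        apply div_nonneg <;> linarith [norm_nonneg z]
      have a4 : (ρ + ‖z‖) / (ρ - ‖z‖) ≤ (ρ + r) / (ρ - r) := by
        apply div_le_div₀ <;> linarith
      have a5 : Real.log ‖H w‖ ≤ log⁺ ‖H w‖ := le_max_right _ _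
      have a6 : 0 ≤ log⁺ ‖H w‖ := posLog_nonneg
      simp only [Pi.smul_apply', Pi.smul_apply, smul_eq_mul, Function.comp_apply,
        herglotzRieszKernel_def, sub_zero] at a1 a2 ⊢
      have a7 := a3.trans a1
      calc _ ≤ _ := mul_le_mul_of_nonneg_left a5 a7
        _ ≤ _ := mul_le_mul_of_nonneg_right (a2.trans a4) a6
  have hc : ContinuousAt (fun ρ => (ρ + r) / (ρ - r) * proximity H ⊤ ρ) R := by
    have := (continuous_proximity_top hH.continuous).continuousAt (x := R)
    have h3 : R - r ≠ 0 := by linarith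
    fun_prop (disch := assumption)
  refine ge_of_tendsto (hc.tendsto.mono_left (nhdsWithin_le_nhds (s := Set.Iio R))) ?_
  filter_upwards [Ioo_mem_nhdsLT hrR] with ρ hρ using key ρ hρ

/-- The Poisson bound for the maximum modulus in terms of the proximity function. -/
lemma log_norm_le_proximity {F : ℂ → ℂ} (hF : Differentiable ℂ F) (h0 : F 0 ≠ 0) {r R : ℝ}
    (hr : 0 ≤ r) (hrR : r < R) {z : ℂ} (hz : ‖z‖ ≤ r) :
    log⁺ ‖F z‖ ≤ (R + r) / (R - r) * proximity F ⊤ R := by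
  have hR : 0 < R := by linarith
  have hnn : 0 ≤ (R + r) / (R - r) * proximity F ⊤ R :=
    mul_nonneg (div_nonneg (by linarith) (by linarith)) (proximity_nonneg R)
  refine max_le hnn ?_
  obtain ⟨N, G, a, hG, hFG, ha, hGne⟩ := exists_zero_factorization hF h0 hR
  have hb : ∀ w ∈ ball (0 : ℂ) R, zeroReflection G a R w ≠ 0 := by
    intro w hw
    rw [mem_ball_zero_iff] at hw
    refine mul_ne_zero (hGne w hw.le) (Finset.prod_ne_zero_iff.2 fun i _ h => ?_)
    rw [div_eq_zero_iff, or_iff_left (by exact_mod_cast hR.ne'), sub_eq_zero] at h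
    have h2 := congrArg norm h
    simp only [norm_pow, norm_mul, norm_real, RCLike.norm_conj, norm_of_nonneg hR.le] at h2
    nlinarith [ha i, norm_nonneg (a i), norm_nonneg w]
  have hp : proximity (zeroReflection G a R) ⊤ R = proximity F ⊤ R := by
    simp only [proximity_top]
    refine circleAverage_congr_sphere fun w hw => ?_
    rw [mem_sphere_zero_iff_norm, abs_of_pos hR] at hw
    simp [norm_zeroReflection_of_norm_eq hFG hR hw]
  rw [← hp]
  by_cases hz0 : F z = 0
  · rw [hz0, norm_zero, Real.log_zero, hp]; exact hnn
  · refine (Real.log_le_log (norm_pos_iff.2 hz0)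
      (norm_le_norm_zeroReflection hFG hR ha (by linarith))).trans ?_
    exact log_norm_le_proximity_of_ne_zero (differentiable_zeroReflection hG) hr hrR hb hz

lemma Real.posLog_add_le_posLog_add {x y : ℝ} (hx : 0 ≤ x) (hy : 0 ≤ y) :
    log⁺ (x + y) ≤ log⁺ x + y := by
  rw [posLog_eq_log_max_one (by positivity), posLog_eq_log_max_one hx]
  have h1 : (1 : ℝ) ≤ max 1 x := le_max_left _ _
  have h2 : max 1 (x + y) ≤ max 1 x * (1 + y) := by
    refine max_le (by nlinarith) ?_
    nlinarith [le_max_right 1 x]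
  refine (Real.log_le_log (by positivity) h2).trans ?_
  rw [Real.log_mul (by positivity) (by positivity)]
  linarith [Real.log_le_sub_one_of_pos (x := 1 + y) (by positivity)]

lemma proximity_inv_sub_const_le (a : ℂ) {r : ℝ} (hr : 0 < r) :
    proximity (fun z => (z - a)⁻¹) ⊤ r ≤ 1 / r := by
  have hm : Meromorphic (fun z : ℂ => z - a) := by
    intro z; fun_prop
  have e1 := congrFun (proximity_sub_proximity_inv_eq_circleAverage hm) r
  rw [Pi.sub_apply, circleAverage_log_norm_sub_const_eq_log_radius_add_posLog hr.ne'] at e1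
  have e2 := congrFun (circleAverage_circleAverage_eq_proximity_top hm) r
  have e3 : circleAverage (fun l => circleAverage (fun z => Real.log ‖z - a - l‖) 0 r) 0 1 ≤
      Real.log r + (log⁺ (r⁻¹ * ‖a‖) + r⁻¹) := by
    apply circleAverage_mono_on_of_le_circle
    · exact circleIntegrable_circleAverage_log_norm_sub hm
    · intro l hl
      simp only [sub_sub]
      rw [circleAverage_log_norm_sub_const_eq_log_radius_add_posLog hr.ne']
      gcongr
      refine (posLog_le_posLog (by positivity) ?_).trans
        (posLog_add_le_posLog_add (by positivity) (by positivity))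
      rw [abs_one, mem_sphere_zero_iff_norm] at hl
      have : ‖0 - (a + l)‖ ≤ ‖a‖ + 1 := by
        rw [zero_sub, norm_neg, ← hl]; exact norm_add_le _ _
      calc _ ≤ r⁻¹ * (‖a‖ + 1) := by gcongr
        _ = _ := by ring
  rw [e2] at e3
  rw [zero_sub, norm_neg] at e1
  have : proximity (fun z => (z - a)⁻¹) ⊤ r = proximity (fun z => z - a)⁻¹ ⊤ r := rfl
  rw [one_div]
  linarith

lemma proximity_const_mul_inv_sub_const_le (a : ℂ) {r ε : ℝ} (hr : 0 < r) (hε : 0 < ε) :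
    proximity (fun z => ε * (z - a)⁻¹) ⊤ r ≤ ε / r := by
  have h := proximity_inv_sub_const_le (a / ε) (div_pos hr hε)
  rw [one_div_div] at h
  refine le_trans (le_of_eq ?_) h
  rw [proximity_top, proximity_top, circleAverage_eq_circleAverage_zero_one,
    circleAverage_eq_circleAverage_zero_one (R := r / ε)]
  congr 1
  ext z
  have : (ε : ℂ) ≠ 0 := by exact_mod_cast hε.ne'
  congr 2
  push_cast
  rw [add_zero, add_zero, div_mul_eq_mul_div, ← sub_div, inv_div, div_eq_mul_inv]

lemma Real.posLog_add_sum_le {N : ℕ} {K ε : ℝ} (hK : 0 ≤ K) (hε : 0 < ε) (x : Fin N → ℝ)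
    (hx : ∀ i, 0 ≤ x i) :
    log⁺ (K + ∑ i, x i) ≤ log⁺ (K + N / ε) + ∑ i, log⁺ (ε * x i) := by
  have h1 : ∀ i, 1 ≤ max 1 (ε * x i) := fun i => le_max_left _ _
  have hP : (1 : ℝ) ≤ ∏ i, max 1 (ε * x i) := Finset.one_le_prod fun i _ => h1 i
  have h2 : ∀ i, x i ≤ 1 / ε * ∏ i, max 1 (ε * x i) := by
    intro i
    have : max 1 (ε * x i) ≤ ∏ i, max 1 (ε * x i) := by
      rw [← Finset.mul_prod_erase _ _ (Finset.mem_univ i)]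
      exact le_mul_of_one_le_right (by linarith [h1 i]) (Finset.one_le_prod fun j _ => h1 j)
    rw [one_div, inv_mul_eq_div, le_div_iff₀' hε]
    exact (le_max_right _ _).trans this
  have h3 : K + ∑ i, x i ≤ (K + N / ε) * ∏ i, max 1 (ε * x i) := by
    have := Finset.sum_le_sum fun i (_ : i ∈ Finset.univ) => h2 i
    simp only [Finset.sum_const, Finset.card_univ, Fintype.card_fin, nsmul_eq_mul] at this
    have h4 : K ≤ K * ∏ i, max 1 (ε * x i) := le_mul_of_one_le_right hK hP
    calc _ ≤ _ := add_le_add h4 this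
      _ = _ := by ring
  have h0 : 0 ≤ K + ∑ i, x i := add_nonneg hK (Finset.sum_nonneg fun i _ => hx i)
  refine (posLog_le_posLog h0 h3).trans (posLog_mul.trans ?_)
  gcongr
  refine (posLog_prod _ _).trans (Finset.sum_le_sum fun i _ => ?_)
  rw [posLog_eq_log (by rw [abs_of_nonneg] <;> linarith [h1 i]),
    posLog_eq_log_max_one (mul_nonneg hε.le (hx i))]

lemma zeroReflection_ne_zero {N : ℕ} {G : ℂ → ℂ} {a : Fin N → ℂ} {R : ℝ} (hR : 0 < R) {z : ℂ}
    (hG : G z ≠ 0) (h : ∀ i, ‖a i‖ * ‖z‖ < R ^ 2) : zeroReflection G a R z ≠ 0 := by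
  refine mul_ne_zero hG (Finset.prod_ne_zero_iff.2 fun i _ h1 => ?_)
  rw [div_eq_zero_iff, or_iff_left (by exact_mod_cast hR.ne'), sub_eq_zero] at h1
  have h2 := congrArg norm h1
  simp only [norm_pow, norm_mul, norm_real, RCLike.norm_conj, norm_of_nonneg hR.le] at h2
  linarith [h i]

lemma logDeriv_eq_logDeriv_zeroReflection {F G : ℂ → ℂ} {N : ℕ} {a : Fin N → ℂ} {R : ℝ}
    (hG : Differentiable ℂ G) (hFG : ∀ z, F z = G z * ∏ i, (z - a i)) (hR : 0 < R) {z : ℂ}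
    (hz : F z ≠ 0) (h : ∀ i, ‖a i‖ * ‖z‖ < R ^ 2) :
    logDeriv F z = logDeriv (zeroReflection G a R) z +
      ∑ i, (starRingEnd ℂ) (a i) / (R ^ 2 - (starRingEnd ℂ) (a i) * z) + ∑ i, (z - a i)⁻¹ := by
  have hz' := hz
  rw [hFG] at hz'
  obtain ⟨h1, h2⟩ := mul_ne_zero_iff.1 hz'
  have h3 := zeroReflection_ne_zero hR h1 h
  obtain ⟨-, h4⟩ := mul_ne_zero_iff.1 h3
  have hR' : (R : ℂ) ≠ 0 := by exact_mod_cast hR.ne'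
  rw [funext hFG, logDeriv_mul z h1 h2 (hG z) (by fun_prop), logDeriv_prod,
    show zeroReflection G a R = fun z => G z * ∏ i, ((R ^ 2 - (starRingEnd ℂ) (a i) * z) / R)
      from rfl, logDeriv_mul z h1 h4 (hG z) (by fun_prop), logDeriv_prod]
  · have e1 : ∀ i, logDeriv (fun z => z - a i) z = (z - a i)⁻¹ := by
      intro i
      simp [logDeriv_apply]
    have e2 : ∀ i, logDeriv (fun z => ((R : ℂ) ^ 2 - (starRingEnd ℂ) (a i) * z) / R) z =
        - ((starRingEnd ℂ) (a i) / (R ^ 2 - (starRingEnd ℂ) (a i) * z)) := by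
      intro i
      have : HasDerivAt (fun z => ((R : ℂ) ^ 2 - (starRingEnd ℂ) (a i) * z) / R)
          (-(starRingEnd ℂ) (a i) / R) z := by
        have := (((hasDerivAt_id z).const_mul ((starRingEnd ℂ) (a i))).const_sub
          ((R : ℂ) ^ 2)).div_const (R : ℂ)
        simpa using this
      rw [logDeriv_apply, this.deriv]
      have := Finset.prod_ne_zero_iff.1 h4 i (Finset.mem_univ i)
      rw [div_ne_zero_iff] at this
      rw [div_div_div_cancel_right₀ hR', neg_div]
    simp only [e1, e2, Finset.sum_neg_distrib]
    ring
  · exact fun i _ => Finset.prod_ne_zero_iff.1 h4 i (Finset.mem_univ i)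
  · intro i _; fun_prop
  · exact fun i _ => Finset.prod_ne_zero_iff.1 h2 i (Finset.mem_univ i)
  · intro i _; fun_prop

set_option maxHeartbeats 800000 in
/-- The lemma on the logarithmic derivative, with an explicit error term. -/
theorem proximity_logDeriv_le {F : ℂ → ℂ} (hF : Differentiable ℂ F) (h0 : F 0 ≠ 0)
    {r δ M A : ℝ} (hr : 1 ≤ r) (hδ : 0 < δ) (hδ1 : δ ≤ 1)
    (hM : ∀ z, ‖z‖ = r + 2 * δ → ‖F z‖ ≤ M) (hA : 1 ≤ A) (hMA : Real.log (M / ‖F 0‖) ≤ A) :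
    proximity (logDeriv F) ⊤ r ≤ 4 + 2 * Real.log (A * (r + 2) / δ) := by
  set R₁ := r + δ with hR₁
  set R₂ := r + 2 * δ with hR₂
  have hR₁0 : 0 < R₁ := by linarith
  have hR₂0 : 0 < R₂ := by linarith
  obtain ⟨N, G, a, hG, hFG, ha, hGne⟩ := exists_zero_factorization hF h0 hR₁0
  have ha2 : ∀ i, ‖a i‖ ≤ R₂ := fun i => (ha i).trans (by linarith)
  have hRR : R₁ * R₁ < R₂ ^ 2 := by nlinarith
  have haz : ∀ z : ℂ, ‖z‖ ≤ R₁ → ∀ i, ‖a i‖ * ‖z‖ < R₂ ^ 2 := by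
    intro z hz i
    exact (mul_le_mul (ha i) hz (norm_nonneg _) hR₁0.le).trans_lt hRR
  set H := zeroReflection G a R₂ with hH
  have hHd : Differentiable ℂ H := differentiable_zeroReflection hG
  have hHne : ∀ z ∈ ball (0 : ℂ) (r + δ), H z ≠ 0 := by
    intro z hz
    rw [mem_ball_zero_iff] at hz
    exact zeroReflection_ne_zero hR₂0 (hGne z hz.le) (haz z hz.le)
  have hHM : ∀ z : ℂ, ‖z‖ ≤ R₂ → ‖H z‖ ≤ M := fun z hz =>
    norm_zeroReflection_le hG hFG hR₂0 hM hz
  have hF0 : 0 < ‖F 0‖ := norm_pos_iff.2 h0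
  have hH0 : ‖F 0‖ * (R₂ / R₁) ^ N ≤ ‖H 0‖ :=
    norm_mul_pow_le_norm_zeroReflection_zero hFG hR₂0 hR₁0 ha
  have hq : 1 ≤ R₂ / R₁ := by rw [one_le_div hR₁0]; linarith
  have hqN : 1 ≤ (R₂ / R₁) ^ N := one_le_pow₀ hq
  have hFH : ‖F 0‖ ≤ ‖H 0‖ := le_trans (le_mul_of_one_le_right hF0.le hqN) hH0
  have hH0M : ‖H 0‖ ≤ M := hHM 0 (by simpa using hR₂0.le)
  have hM0 : 0 < M := by linarith
  have hlogH : Real.log (M / ‖H 0‖) ≤ A := by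
    have := hF0.trans_le hFH
    refine (Real.log_le_log (by positivity) ?_).trans hMA
    gcongr
  set X := A * (r + 2) / δ with hX
  have hX1 : 1 ≤ X := by
    rw [hX, one_le_div hδ]; nlinarith
  have hN : (N : ℝ) ≤ X := by
    have e1 : N * Real.log (R₂ / R₁) ≤ A := by
      rw [← Real.log_pow]
      refine (Real.log_le_log (by positivity) ?_).trans hMA
      rw [le_div_iff₀ hF0]
      linarith
    have e2 : δ / R₂ ≤ Real.log (R₂ / R₁) := by
      have := Real.one_sub_inv_le_log_of_pos (x := R₂ / R₁) (by positivity)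
      rw [inv_div] at this
      refine le_trans (le_of_eq ?_) this
      rw [eq_sub_iff_add_eq, ← add_div, div_eq_one_iff_eq hR₂0.ne']
      linarith
    have e3 : N * (δ / R₂) ≤ A := le_trans (by gcongr) e1
    rw [hX, le_div_iff₀ hδ]
    rw [mul_div_assoc', div_le_iff₀ hR₂0] at e3
    refine e3.trans ?_
    gcongr
    linarith
  set K := 8 * A * (r + δ) / δ ^ 2 + N / δ with hK
  have hK0 : 0 ≤ K := by positivity
  set ε : ℝ := 1 / (N + 1) with hε
  have hε0 : 0 < ε := by positivity
  have hpt : ∀ z ∈ sphere (0 : ℂ) |r|, log⁺ ‖logDeriv F z‖ ≤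
      log⁺ (K + N / ε) + ∑ i, log⁺ ‖ε * (z - a i)⁻¹‖ := by
    intro z hz
    rw [mem_sphere_zero_iff_norm, abs_of_pos (by linarith)] at hz
    have hi : ∀ i, ‖(ε : ℂ) * (z - a i)⁻¹‖ = ε * ‖(z - a i)⁻¹‖ := by
      intro i; rw [norm_mul, norm_real, norm_of_nonneg hε0.le]
    simp only [hi]
    refine le_trans (posLog_le_posLog (norm_nonneg _) ?_)
      (posLog_add_sum_le hK0 hε0 _ fun i => norm_nonneg _)
    have hnn : 0 ≤ K + ∑ i, ‖(z - a i)⁻¹‖ := by positivity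
    by_cases hz0 : F z = 0
    · rw [logDeriv_apply, hz0, div_zero, norm_zero]
      exact hnn
    rw [logDeriv_eq_logDeriv_zeroReflection hG hFG hR₂0 hz0 (haz z (by linarith))]
    refine (norm_add_le _ _).trans (add_le_add ((norm_add_le _ _).trans ?_) (norm_sum_le _ _))
    rw [hK]
    refine add_le_add (norm_logDeriv_le_of_ne_zero hHd (by linarith) hδ (by linarith) hHne
      (fun w hw => hHM w (by rw [mem_ball_zero_iff] at hw; linarith)) hlogH hz.le) ?_
    have e : ∀ i ∈ Finset.univ, ‖(starRingEnd ℂ) (a i) / (R₂ ^ 2 - (starRingEnd ℂ) (a i) * z)‖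
        ≤ 1 / δ := by
      intro i _
      have := norm_sub_norm_le ((R₂ : ℂ) ^ 2) ((starRingEnd ℂ) (a i) * z)
      rw [norm_pow, norm_real, norm_mul, RCLike.norm_conj, norm_of_nonneg hR₂0.le, hz] at this
      have h5 := ha i
      have h6 : ‖a i‖ * r ≤ R₁ * r := by gcongr
      have h7 : R₁ * δ ≤ R₂ ^ 2 - R₁ * r := by nlinarith
      rw [norm_div, RCLike.norm_conj]
      have h8 : 0 < R₁ * δ := by positivity
      rw [div_le_div_iff₀ (by linarith) hδ]
      have : ‖a i‖ * δ ≤ R₁ * δ := by gcongr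
      linarith
    refine (norm_sum_le _ _).trans ((Finset.sum_le_sum e).trans (le_of_eq ?_))
    simp [div_eq_mul_inv]
  have hmero : Meromorphic (logDeriv F) := fun z =>
    ((hF.deriv.analyticAt z).meromorphicAt).div (hF.analyticAt z).meromorphicAt
  have hmi : ∀ i, Meromorphic (fun z : ℂ => (ε : ℂ) * (z - a i)⁻¹) := by
    intro i z; fun_prop
  have hci : ∀ i, CircleIntegrable (fun z => log⁺ ‖(ε : ℂ) * (z - a i)⁻¹‖) 0 r := fun i =>
    (hmi i).meromorphicOn.circleIntegrable_posLog_norm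
  have hmain : proximity (logDeriv F) ⊤ r ≤ log⁺ (K + N / ε) +
      ∑ i, proximity (fun z => ε * (z - a i)⁻¹) ⊤ r := by
    have hcs : CircleIntegrable (fun z => ∑ i, log⁺ ‖(ε : ℂ) * (z - a i)⁻¹‖) 0 r := by
      have := CircleIntegrable.sum Finset.univ fun i _ => hci i
      convert this using 1
      ext z; simp
    simp only [proximity_top]
    rw [← circleAverage_fun_sum fun i _ => hci i, ← circleAverage_const (log⁺ (K + N / ε)) 0 r,
      ← circleAverage_fun_add (circleIntegrable_const _ _ _) hcs]
    exact circleAverage_mono hmero.meromorphicOn.circleIntegrable_posLog_norm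
      ((circleIntegrable_const _ _ _).add hcs) hpt
  have hs : ∑ i, proximity (fun z => ε * (z - a i)⁻¹) ⊤ r ≤ 1 := by
    refine (Finset.sum_le_sum fun i _ => (proximity_const_mul_inv_sub_const_le (a i)
      (by linarith) hε0).trans (div_le_self hε0.le hr)).trans ?_
    simp only [Finset.sum_const, Finset.card_univ, Fintype.card_fin, nsmul_eq_mul, hε]
    rw [mul_one_div, div_le_one (by positivity)]
    linarith
  have hKb : K + N / ε ≤ 11 * X ^ 2 := by
    have e1 : 8 * A * (r + δ) / δ ^ 2 ≤ 8 * X ^ 2 := by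
      have h1 : A * (r + δ) ≤ A * (r + 2) := by gcongr; linarith
      have h2 : 1 ≤ A * (r + 2) := by nlinarith
      have h3 : 8 * A * (r + δ) ≤ 8 * (A * (r + 2)) ^ 2 := by nlinarith
      rw [hX, div_pow, mul_div_assoc']
      exact div_le_div_of_nonneg_right h3 (by positivity)
    have e2 : N / δ ≤ X ^ 2 := by
      have : 1 / δ ≤ X := by
        rw [hX]; gcongr; nlinarith
      calc N / δ = N * (1 / δ) := by ring
        _ ≤ X * X := by gcongr
        _ = X ^ 2 := by ring
    have e3 : N / ε ≤ 2 * X ^ 2 := by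
      rw [hε, div_div_eq_mul_div, div_one]
      nlinarith [Nat.cast_nonneg (α := ℝ) N]
    linarith
  have hlog : log⁺ (K + N / ε) ≤ 3 + 2 * Real.log X := by
    refine (posLog_le_posLog (by positivity) hKb).trans ?_
    rw [posLog_eq_log (by rw [abs_of_nonneg (by positivity)]; nlinarith),
      Real.log_mul (by norm_num) (by positivity), Real.log_pow]
    have : Real.log 11 ≤ 3 := by
      rw [Real.log_le_iff_le_exp (by norm_num)]
      have := Real.exp_one_gt_d9
      have h3 : Real.exp 3 = Real.exp 1 ^ 3 := by rw [← Real.exp_nat_mul]; norm_num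
      rw [h3]
      calc (11 : ℝ) ≤ 2.7 ^ 3 := by norm_num
        _ ≤ _ := by gcongr; linarith
    push_cast
    linarith
  linarith

lemma Differentiable.meromorphic {g : ℂ → ℂ} (hg : Differentiable ℂ g) : Meromorphic g :=
  fun z => (hg.analyticAt z).meromorphicAt

lemma Differentiable.iteratedDeriv_complex {g : ℂ → ℂ} (hg : Differentiable ℂ g) (j : ℕ) :
    Differentiable ℂ (iteratedDeriv j g) := by
  induction j with
  | zero => simpa using hg
  | succ j ih => rw [iteratedDeriv_succ]; exact ih.deriv

lemma Differentiable.eventually_ne_zero {g : ℂ → ℂ} (hg : Differentiable ℂ g) {z₀ : ℂ}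
    (h0 : g z₀ ≠ 0) : ∀ᶠ z in codiscrete ℂ, g z ≠ 0 :=
  AnalyticOnNhd.preimage_zero_mem_codiscrete (fun z _ => hg.analyticAt z) h0

lemma log_norm_le_circleAverage {g : ℂ → ℂ} (hg : Differentiable ℂ g) (h0 : g 0 ≠ 0) {r : ℝ}
    (hr : 0 < r) : Real.log ‖g 0‖ ≤ circleAverage (fun z => Real.log ‖g z‖) 0 r := by
  have hgn : AnalyticOnNhd ℂ g (closedBall 0 |r|) := fun z _ => hg.analyticAt z
  rw [hgn.circleAverage_log_norm hr.ne' h0, le_add_iff_nonneg_left]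
  refine finsum_nonneg fun u => ?_
  by_cases hu : u ∈ closedBall (0 : ℂ) |r|
  · refine mul_nonneg (by exact_mod_cast MeromorphicOn.AnalyticOnNhd.divisor_nonneg hgn u) ?_
    rw [zero_sub, norm_neg]
    rw [mem_closedBall_zero_iff, abs_of_pos hr] at hu
    rcases (norm_nonneg u).eq_or_lt with h | h
    · simp [← h]
    · exact Real.log_nonneg (by rwa [← div_eq_mul_inv, one_le_div h])
  · rw [Function.locallyFinsuppWithin.apply_eq_zero_of_notMem _ hu]
    simp

/-- The gauge in which the error terms of value distribution theory are measured. -/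
noncomputable def growthGauge (f : ℂ → ℂ) (r δ : ℝ) : ℝ :=
  (1 + proximity f ⊤ (r + 4 * δ)) * (r + 4) / δ

/-- `S` is bounded by a multiple of the logarithm of the gauge of `f`. -/
def IsSmallError (f : ℂ → ℂ) (S : ℝ → ℝ) : Prop :=
  ∃ C : ℝ, 0 ≤ C ∧ ∀ r δ, 1 ≤ r → 0 < δ → δ ≤ 1 → S r ≤ C * (1 + Real.log (growthGauge f r δ))

/-- The logarithm of the maximum modulus of `g` is bounded by a multiple of the gauge of `f`. -/
def IsGaugeBounded (f g : ℂ → ℂ) : Prop :=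
  ∃ C : ℝ, 0 ≤ C ∧ ∀ r δ, 1 ≤ r → 0 < δ → δ ≤ 1 → ∀ z : ℂ, ‖z‖ ≤ r + 2 * δ →
    log⁺ ‖g z‖ ≤ C * growthGauge f r δ

section gauge

variable {f g : ℂ → ℂ} {r δ : ℝ}

lemma div_le_growthGauge (hr : 1 ≤ r) (hδ : 0 < δ) : (r + 4) / δ ≤ growthGauge f r δ := by
  rw [growthGauge]
  gcongr
  exact le_mul_of_one_le_left (by linarith)
    (le_add_of_nonneg_right (proximity_nonneg (f := f) (r + 4 * δ)))

lemma one_le_growthGauge (hr : 1 ≤ r) (hδ : 0 < δ) (hδ1 : δ ≤ 1) : 1 ≤ growthGauge f r δ :=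
  le_trans (by rw [one_le_div hδ]; linarith) (div_le_growthGauge hr hδ)

lemma IsSmallError.const (C : ℝ) : IsSmallError f fun _ => C := by
  refine ⟨|C|, abs_nonneg C, fun r δ hr hδ hδ1 => (le_abs_self C).trans ?_⟩
  exact le_mul_of_one_le_right (abs_nonneg C)
    (le_add_of_nonneg_right (Real.log_nonneg (one_le_growthGauge hr hδ hδ1)))

lemma IsSmallError.add {S T : ℝ → ℝ} (hS : IsSmallError f S) (hT : IsSmallError f T) :
    IsSmallError f fun r => S r + T r := by
  obtain ⟨C, hC, h⟩ := hS
  obtain ⟨D, hD, h'⟩ := hT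
  refine ⟨C + D, add_nonneg hC hD, fun r δ hr hδ hδ1 => ?_⟩
  rw [add_mul]
  exact add_le_add (h r δ hr hδ hδ1) (h' r δ hr hδ hδ1)

lemma IsSmallError.mono {S T : ℝ → ℝ} (hS : IsSmallError f S) (h : ∀ r, 1 ≤ r → T r ≤ S r) :
    IsSmallError f T := by
  obtain ⟨C, hC, h'⟩ := hS
  exact ⟨C, hC, fun r δ hr hδ hδ1 => (h r hr).trans (h' r δ hr hδ hδ1)⟩

lemma IsGaugeBounded.isSmallError_logDeriv (hg : Differentiable ℂ g) (h0 : g 0 ≠ 0)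
    (h : IsGaugeBounded f g) : IsSmallError f (proximity (logDeriv g) ⊤) := by
  obtain ⟨C, hC, h⟩ := h
  set c := log⁺ ‖g 0‖⁻¹ with hc
  have hc0 : 0 ≤ c := posLog_nonneg
  refine ⟨4 + 2 * Real.log (1 + C + c) + 4, ?_, fun r δ hr hδ hδ1 => ?_⟩
  · have := Real.log_nonneg (by linarith : 1 ≤ 1 + C + c)
    linarith
  set E := growthGauge f r δ with hE
  have hE1 : 1 ≤ E := one_le_growthGauge hr hδ hδ1
  have hb := proximity_logDeriv_le hg h0 (M := Real.exp (C * E)) (A := (1 + C + c) * E) hr hδ hδ1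
    (fun z hz => by
      have := h r δ hr hδ hδ1 z hz.le
      rcases eq_or_ne (g z) 0 with h1 | h1
      · rw [h1, norm_zero]; exact (Real.exp_pos _).le
      · rw [← Real.log_le_iff_le_exp (norm_pos_iff.2 h1)]
        exact (le_max_right _ _).trans this)
    (by nlinarith)
    (by
      rw [Real.log_div (Real.exp_ne_zero _) (norm_ne_zero_iff.2 h0), Real.log_exp, sub_eq_add_neg,
        ← Real.log_inv]
      have : Real.log ‖g 0‖⁻¹ ≤ c := le_max_right _ _
      nlinarith)
  have e1 : (1 + C + c) * E * (r + 2) / δ ≤ (1 + C + c) * E ^ 2 := by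
    have : (r + 2) / δ ≤ E := le_trans (by gcongr; linarith) (div_le_growthGauge hr hδ)
    calc _ = (1 + C + c) * E * ((r + 2) / δ) := by ring
      _ ≤ (1 + C + c) * E * E := by gcongr
      _ = _ := by ring
  have e2 := Real.log_le_log (by positivity) e1
  rw [Real.log_mul (by positivity) (by positivity), Real.log_pow] at e2
  push_cast at e2
  have e3 := Real.log_nonneg hE1
  have e4 := Real.log_nonneg (by linarith : 1 ≤ 1 + C + c)
  nlinarith [mul_nonneg e3 e4]

lemma isGaugeBounded_iteratedDeriv_pow (hf : Differentiable ℂ f) (h0 : f 0 ≠ 0) (n j : ℕ) :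
    IsGaugeBounded f (iteratedDeriv j fun z => f z ^ n) := by
  refine ⟨Real.log j.factorial + j + n * 2, by positivity, fun r δ hr hδ hδ1 z hz => ?_⟩
  set E := growthGauge f r δ with hE
  have hE1 : 1 ≤ E := one_le_growthGauge hr hδ hδ1
  have hd : Differentiable ℂ fun z => f z ^ n := hf.pow n
  have hB : ∀ w ∈ sphere z δ, ‖f w ^ n‖ ≤ Real.exp (n * 2 * E) := by
    intro w hw
    have hw' : ‖w‖ ≤ r + 3 * δ := by
      rw [mem_sphere_iff_norm] at hw
      have := norm_le_norm_add_norm_sub' w z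
      linarith
    have := log_norm_le_proximity hf h0 (by linarith) (by linarith : r + 3 * δ < r + 4 * δ) hw'
    have h1 : log⁺ ‖f w‖ ≤ 2 * E := by
      refine this.trans ?_
      have hp : 0 ≤ proximity f ⊤ (r + 4 * δ) := proximity_nonneg _
      rw [hE, growthGauge, show r + 4 * δ - (r + 3 * δ) = δ by ring, div_mul_eq_mul_div,
        mul_div_assoc']
      refine div_le_div_of_nonneg_right ?_ hδ.le
      nlinarith
    rcases eq_or_ne (f w ^ n) 0 with h2 | h2
    · rw [h2, norm_zero]; exact (Real.exp_pos _).le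
    · rw [← Real.log_le_iff_le_exp (norm_pos_iff.2 h2), norm_pow, Real.log_pow, mul_assoc]
      gcongr
      exact (le_max_right _ _).trans h1
  have hcau := norm_iteratedDeriv_le_of_forall_mem_sphere_norm_le j hδ hd.diffContOnCl hB
  refine (posLog_le_posLog (norm_nonneg _) hcau).trans ?_
  rw [div_eq_mul_inv, ← inv_pow]
  refine posLog_mul.trans ?_
  rw [posLog_pow]
  refine (add_le_add_left posLog_mul _).trans ?_
  have h1 : log⁺ δ⁻¹ ≤ E := by
    have h3 : δ⁻¹ ≤ E := le_trans (by rw [← one_div]; gcongr; linarith)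
      (div_le_growthGauge hr hδ)
    refine le_trans (max_le (by positivity) ?_) h3
    exact Real.log_le_self (by positivity)
  have h2 : log⁺ (Real.exp (n * 2 * E)) = n * 2 * E := by
    rw [posLog_apply, Real.log_exp, max_eq_right (by positivity)]
  rw [h2, log_of_nat_eq_posLog]
  have h3 : 0 ≤ Real.log (j.factorial : ℝ) := Real.log_natCast_nonneg _
  have h4 : (j : ℝ) * log⁺ δ⁻¹ ≤ j * E := by gcongr
  nlinarith

lemma IsGaugeBounded.sub_const (hg : IsGaugeBounded f g) (c : ℂ) :
    IsGaugeBounded f fun z => g z - c := by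
  obtain ⟨C, hC, h⟩ := hg
  have hc : 0 ≤ log⁺ ‖-c‖ := posLog_nonneg
  have h2 : 0 ≤ Real.log 2 := Real.log_nonneg (by norm_num)
  refine ⟨C + log⁺ ‖-c‖ + Real.log 2, by positivity, fun r δ hr hδ hδ1 z hz => ?_⟩
  have := one_le_growthGauge (f := f) hr hδ hδ1
  simp only [sub_eq_add_neg]
  refine (posLog_norm_add_le _ _).trans ?_
  have := h r δ hr hδ hδ1 z hz
  nlinarith

lemma isSmallError_iteratedDeriv_div (hf : Differentiable ℂ f) (h0 : f 0 ≠ 0) {n k : ℕ}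
    (hj : ∀ j < k, iteratedDeriv j (fun z => f z ^ n) 0 ≠ 0) :
    IsSmallError f (proximity (fun z => iteratedDeriv k (fun z => f z ^ n) z / f z ^ n) ⊤) := by
  have hd : Differentiable ℂ fun z => f z ^ n := hf.pow n
  induction k with
  | zero =>
    refine (IsSmallError.const 0).mono fun r hr => ?_
    rw [proximity_congr_codiscrete (g := fun _ => 1) _ (by linarith), proximity_const]
    · simp
    · filter_upwards [hf.eventually_ne_zero h0] with z hz
      simp [hz]
  | succ k ih =>
    have hk := hj k (Nat.lt_succ_self k)
    have hdk := hd.iteratedDeriv_complex k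
    have hm1 : Meromorphic (logDeriv (iteratedDeriv k fun z => f z ^ n)) :=
      hdk.deriv.meromorphic.div hdk.meromorphic
    have hm2 : Meromorphic (fun z => iteratedDeriv k (fun z => f z ^ n) z / f z ^ n) :=
      hdk.meromorphic.div hd.meromorphic
    refine (((isGaugeBounded_iteratedDeriv_pow hf h0 n k).isSmallError_logDeriv hdk hk).add
      (ih fun j hj' => hj j (hj'.trans (Nat.lt_succ_self k)))).mono fun r hr => ?_
    rw [proximity_congr_codiscrete (g := logDeriv (iteratedDeriv k fun z => f z ^ n) *
      fun z => iteratedDeriv k (fun z => f z ^ n) z / f z ^ n) _ (by linarith)]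
    · exact proximity_mul_top_le hm1 hm2 r
    · filter_upwards [hdk.eventually_ne_zero hk] with z hz
      rw [Pi.mul_apply, logDeriv_apply, iteratedDeriv_succ]
      field_simp

end gauge

lemma proximity_inv_le_sub_log {g : ℂ → ℂ} (hg : Differentiable ℂ g) (h0 : g 0 ≠ 0) {r : ℝ}
    (hr : 0 < r) : proximity g⁻¹ ⊤ r ≤ proximity g ⊤ r - Real.log ‖g 0‖ := by
  have h1 := congrFun (proximity_sub_proximity_inv_eq_circleAverage hg.meromorphic) r
  rw [Pi.sub_apply] at h1
  linarith [log_norm_le_circleAverage hg h0 hr]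

/-- The proximity function of `f` is small compared to itself if the derivatives of a power of `f`
satisfy the given differential equation with an entire coefficient `ψ`. -/
theorem isSmallError_proximity_of_differential_equation {f ψ : ℂ → ℂ} (hf : Differentiable ℂ f)
    (hψ : Differentiable ℂ ψ) {n k : ℕ} (hn : 1 ≤ n)
    (heq : ∀ z, f z * ψ z * (f z ^ n - 1) * f z ^ n = deriv (fun z => f z ^ n) z *
      (iteratedDeriv k (fun z => f z ^ n) z - f z ^ n))
    (hf0 : f 0 ≠ 0) (hψ0 : ψ 0 ≠ 0) (hf1 : f 0 ^ n - 1 ≠ 0)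
    (hj : ∀ j < k, iteratedDeriv j (fun z => f z ^ n) 0 ≠ 0) :
    IsSmallError f (proximity f ⊤) := by
  set F : ℂ → ℂ := fun z => f z ^ n with hF
  have hFd : Differentiable ℂ F := hf.pow n
  have hF1d : Differentiable ℂ (fun z => F z - 1) := hFd.sub_const 1
  set φ : ℂ → ℂ := fun z => f z * ψ z with hφ
  have hφd : Differentiable ℂ φ := hf.mul hψ
  have hφ0 : φ 0 ≠ 0 := mul_ne_zero hf0 hψ0
  have hF0 : F 0 ≠ 0 := pow_ne_zero n hf0
  set Q₀ := logDeriv F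
  set Q₁ := logDeriv (fun z => F z - 1)
  set Q₂ : ℂ → ℂ := fun z => iteratedDeriv k F z / F z
  have hQ₀m : Meromorphic Q₀ := hFd.deriv.meromorphic.div hFd.meromorphic
  have hQ₁m : Meromorphic Q₁ := hF1d.deriv.meromorphic.div hF1d.meromorphic
  have hQ₂m : Meromorphic Q₂ := (hFd.iteratedDeriv_complex k).meromorphic.div hFd.meromorphic
  have hFb : IsGaugeBounded f F := by
    have := isGaugeBounded_iteratedDeriv_pow hf hf0 n 0
    rwa [iteratedDeriv_zero] at this
  have hQ₀ : IsSmallError f (proximity Q₀ ⊤) := hFb.isSmallError_logDeriv hFd hF0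
  have hQ₁ : IsSmallError f (proximity Q₁ ⊤) := (hFb.sub_const 1).isSmallError_logDeriv hF1d hf1
  have hQ₂ : IsSmallError f (proximity Q₂ ⊤) := isSmallError_iteratedDeriv_div hf hf0 hj
  have hc : Meromorphic (fun _ : ℂ => (1 : ℂ)) := fun z => by fun_prop
  have hcn : Meromorphic (fun _ : ℂ => (-1 : ℂ)) := fun z => by fun_prop
  have hcod := ((hFd.eventually_ne_zero hF0).and (hF1d.eventually_ne_zero hf1)).and
    ((hφd.eventually_ne_zero hφ0))
  have hφe : IsSmallError f (proximity φ ⊤) := by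
    refine (hQ₁.add (hQ₂.add (IsSmallError.const (Real.log 2)))).mono fun r hr => ?_
    rw [proximity_congr_codiscrete (g := Q₁ * (Q₂ + fun _ => -1)) _ (by linarith)]
    · have h1 := proximity_mul_top_le hQ₁m (hQ₂m.add hcn) r
      have h2 := proximity_add_top_le hQ₂m hcn r
      simp only [Pi.add_apply, proximity_const, norm_neg, norm_one, posLog_one] at h1 h2
      linarith
    · filter_upwards [hcod] with z ⟨⟨h1, h2⟩, h3⟩
      have := heq z
      have h4 : Q₁ z = deriv F z / (F z - 1) := by
        simp only [Q₁, logDeriv_apply, deriv_sub_const]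
      rw [Pi.mul_apply, Pi.add_apply, h4]
      simp only [Q₂, φ]
      field_simp
      linear_combination this
  have hFe : IsSmallError f (proximity F⁻¹ ⊤) := by
    refine (((hφe.add (IsSmallError.const (-Real.log ‖φ 0‖))).add hφe).add (hQ₀.add
      (hQ₂.add (IsSmallError.const (2 * Real.log 2))))).mono fun r hr => ?_
    rw [proximity_congr_codiscrete (g := φ⁻¹ * (φ + Q₀ * ((fun _ => 1) + (fun _ => -1) * Q₂))) _
      (by linarith)]
    · have hm1 := hcn.mul hQ₂m
      have hm2 := hc.add hm1
      have h1 := proximity_mul_top_le hφd.meromorphic.inv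
        (hφd.meromorphic.add (hQ₀m.mul hm2)) r
      have h2 := proximity_add_top_le hφd.meromorphic (hQ₀m.mul hm2) r
      have h3 := proximity_mul_top_le hQ₀m hm2 r
      have h4 := proximity_add_top_le hc hm1 r
      have h5 := proximity_mul_top_le hcn hQ₂m r
      have h6 := proximity_inv_le_sub_log hφd hφ0 (by linarith : 0 < r)
      simp only [Pi.add_apply, proximity_const, norm_neg, norm_one, posLog_one] at h1 h2 h3 h4 h5
      linarith
    · filter_upwards [hcod] with z ⟨⟨h1, h2⟩, h3⟩
      have := heq z
      have h4 : Q₀ z = deriv F z / F z := logDeriv_apply _ _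
      simp only [Pi.mul_apply, Pi.add_apply, Pi.inv_apply, h4]
      simp only [Q₂]
      rw [inv_mul_eq_div, eq_div_iff h3]
      field_simp
      simp only [φ] at *
      linear_combination -this
  refine ((hφe.add (IsSmallError.const (-Real.log ‖ψ 0‖))).add hFe).mono fun r hr => ?_
  have hr0 : 0 < r := by linarith
  have e1 := congrFun (proximity_sub_proximity_inv_eq_circleAverage hf.meromorphic) r
  have e2 := congrFun (proximity_sub_proximity_inv_eq_circleAverage hφd.meromorphic) r
  rw [Pi.sub_apply] at e1 e2
  have e3 : circleAverage (fun z => Real.log ‖φ z‖) 0 r =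
      circleAverage (fun z => Real.log ‖f z‖) 0 r + circleAverage (fun z => Real.log ‖ψ z‖) 0 r := by
    rw [← circleAverage_fun_add hf.meromorphic.meromorphicOn.circleIntegrable_log_norm
      hψ.meromorphic.meromorphicOn.circleIntegrable_log_norm]
    refine circleAverage_congr_codiscreteWithin ?_ hr0.ne'
    have : ∀ᶠ z in codiscrete ℂ, Real.log ‖φ z‖ = Real.log ‖f z‖ + Real.log ‖ψ z‖ := by
      filter_upwards [hφd.eventually_ne_zero hφ0] with z hz
      obtain ⟨h1, h2⟩ := mul_ne_zero_iff.1 hz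
      rw [← Real.log_mul (norm_ne_zero_iff.2 h1) (norm_ne_zero_iff.2 h2), ← norm_mul]
    exact this.filter_mono (codiscreteWithin_mono (Set.subset_univ _))
  have e4 := log_norm_le_circleAverage hψ hψ0 hr0
  have e5 : proximity f⁻¹ ⊤ r ≤ proximity F⁻¹ ⊤ r := by
    have : F⁻¹ = f⁻¹ ^ n := by
      ext z; simp [F]
    rw [this, proximity_pow_top, nsmul_eq_mul, Pi.mul_apply]
    have h1 : 0 ≤ proximity f⁻¹ ⊤ r := proximity_nonneg r
    have h2 : (1 : ℝ) ≤ n := by exact_mod_cast hn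
    simpa using le_mul_of_one_le_left h1 h2
  have e6 : 0 ≤ proximity φ⁻¹ ⊤ r := proximity_nonneg r
  linarith

/-- Borel's growth lemma. -/
lemma exists_le_two_mul_of_continuous {U : ℝ → ℝ} (hU : Continuous U) (h1 : ∀ r, 1 ≤ U r)
    (r₀ : ℝ) : ∃ r, r₀ ≤ r ∧ U (r + 4 / U r) ≤ 2 * U r := by
  by_contra! h
  let s : ℕ → ℝ := fun i => (fun r => r + 4 / U r)^[i] r₀
  have hs : ∀ i, s (i + 1) = s i + 4 / U (s i) := fun i => Function.iterate_succ_apply' _ _ _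
  have hpos : ∀ r, 0 < U r := fun r => by linarith [h1 r]
  have key : ∀ i, r₀ ≤ s i ∧ s i ≤ r₀ + 8 * (1 - (1 / 2) ^ i) ∧ 2 ^ i ≤ U (s i) := by
    intro i
    induction i with
    | zero => simp [s, h1]
    | succ i ih =>
      obtain ⟨ha, hb, hc⟩ := ih
      have hq : 4 / U (s i) ≤ 4 * (1 / 2) ^ i := by
        rw [one_div, inv_pow, div_eq_mul_inv]
        gcongr
      have hq0 : 0 < 4 / U (s i) := div_pos (by norm_num) (hpos _)
      have := h (s i) ha
      rw [hs, pow_succ, pow_succ]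
      exact ⟨by linarith, by linarith, by linarith⟩
  obtain ⟨B, hB⟩ := (isCompact_Icc (a := r₀) (b := r₀ + 8)).bddAbove_image hU.continuousOn
  obtain ⟨i, hi⟩ := pow_unbounded_of_one_lt B (by norm_num : (1 : ℝ) < 2)
  obtain ⟨ha, hb, hc⟩ := key i
  have : U (s i) ≤ B := hB ⟨s i, ⟨ha, hb.trans (by
    have : (0 : ℝ) ≤ (1 / 2) ^ i := by positivity
    linarith)⟩, rfl⟩
  linarith

lemma exists_polynomial_of_frequently_bound {f : ℂ → ℂ} (hf : Differentiable ℂ f) {C : ℝ} {p : ℕ}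
    (h : ∀ R₀ : ℝ, ∃ R, R₀ ≤ R ∧ ∀ z : ℂ, ‖z‖ ≤ R → ‖f z‖ ≤ C * R ^ p) :
    ∃ P : Polynomial ℂ, ∀ z, f z = P.eval z := by
  have hC : 0 ≤ C := by
    obtain ⟨R, hR, hb⟩ := h 1
    by_contra! hC
    have := (norm_nonneg _).trans (hb 0 (by simpa using by linarith))
    have : 0 < R ^ p := by positivity
    nlinarith
  have hz : ∀ m, p < m → iteratedDeriv m f 0 = 0 := by
    intro m hm
    by_contra hne
    have hpos : 0 < ‖iteratedDeriv m f 0‖ := norm_pos_iff.2 hne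
    obtain ⟨R, hR, hb⟩ := h (m.factorial * C / ‖iteratedDeriv m f 0‖ + 1)
    have hR1 : 1 ≤ R := le_trans (le_add_of_nonneg_left (by positivity)) hR
    have := norm_iteratedDeriv_le_of_forall_mem_sphere_norm_le m (by linarith : 0 < R)
      hf.diffContOnCl (fun z hz => hb z (by rw [mem_sphere_zero_iff_norm] at hz; exact hz.le))
    rw [le_div_iff₀ (by positivity)] at this
    have h2 : R ^ p * R ≤ R ^ m := by
      rw [← pow_succ]; exact pow_le_pow_right₀ hR1 hm
    have h3 : m.factorial * C < R * ‖iteratedDeriv m f 0‖ := by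
      rw [← div_lt_iff₀ hpos]; linarith
    have h4 : 0 < R ^ p := by positivity
    nlinarith [mul_le_mul_of_nonneg_left h2 hpos.le, mul_lt_mul_of_pos_left h3 h4]
  refine ⟨∑ m ∈ Finset.range (p + 1), Polynomial.monomial m ((m.factorial : ℂ)⁻¹ *
    iteratedDeriv m f 0), fun z => ?_⟩
  rw [← taylorSeries_eq_of_entire' (c := 0) (z := z) hf, tsum_eq_sum (s := Finset.range (p + 1)),
    Polynomial.eval_finsetSum]
  · simp
  · intro m hm
    rw [hz m (by simpa [Nat.lt_succ_iff] using hm)]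
    simp

/-- An entire function whose proximity function is small compared to itself is a polynomial. -/
theorem IsSmallError.exists_polynomial {f : ℂ → ℂ} (hf : Differentiable ℂ f) (h0 : f 0 ≠ 0)
    (h : IsSmallError f (proximity f ⊤)) : ∃ P : Polynomial ℂ, ∀ z, f z = P.eval z := by
  obtain ⟨C, hC, h⟩ := h
  have hT : Continuous (proximity f ⊤) := continuous_proximity_top hf.continuous
  set D : ℝ := 2 * (1 + C * (1 + Real.log 2) + 2 * C * Real.log (4 * C + 1)) + 2 * C with hD
  have hl2 : 0 ≤ Real.log 2 := Real.log_nonneg (by norm_num)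
  have hl4 : 0 ≤ Real.log (4 * C + 1) := Real.log_nonneg (by linarith)
  have hDT : ∀ r₀, ∃ r, r₀ ≤ r ∧ 5 ≤ r ∧ proximity f ⊤ r ≤ D * (1 + Real.log (r + 4)) := by
    intro r₀
    obtain ⟨r, hr, hU⟩ := exists_le_two_mul_of_continuous (U := fun r => 1 + proximity f ⊤ r)
      (by fun_prop) (fun r => le_add_of_nonneg_right (proximity_nonneg r)) (max r₀ 5)
    have hr5 : 5 ≤ r := (le_max_right _ _).trans hr
    refine ⟨r, (le_max_left _ _).trans hr, hr5, ?_⟩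
    set U := 1 + proximity f ⊤ r with hUdef
    have hU1 : 1 ≤ U := le_add_of_nonneg_right (proximity_nonneg r)
    have hU0 : 0 < U := by linarith
    have hb := h r (1 / U) (by linarith) (by positivity) (by rwa [div_le_one hU0])
    have hg : growthGauge f r (1 / U) ≤ 2 * U ^ 2 * (r + 4) := by
      rw [growthGauge, div_div_eq_mul_div, div_one, mul_one_div]
      nlinarith [mul_le_mul_of_nonneg_right hU (by positivity : 0 ≤ U * (r + 4))]
    have hg0 : 0 < growthGauge f r (1 / U) := zero_lt_one.trans_le
      (one_le_growthGauge (by linarith) (by positivity) (by rwa [div_le_one hU0]))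
    have hlg := Real.log_le_log hg0 hg
    rw [Real.log_mul (by positivity) (by positivity), Real.log_mul (by norm_num) (by positivity),
      Real.log_pow] at hlg
    push_cast at hlg
    have hlU0 := Real.log_nonneg hU1
    have hlr : 0 ≤ Real.log (r + 4) := Real.log_nonneg (by linarith)
    have hlU' : 4 * C * Real.log U ≤ U + 4 * C * Real.log (4 * C + 1) := by
      have := Real.log_le_sub_one_of_pos (x := U / (4 * C + 1)) (by positivity)
      rw [Real.log_div (by positivity) (by positivity)] at this
      have h4 : 4 * C * (U / (4 * C + 1)) ≤ U := by
        rw [mul_div_assoc', div_le_iff₀ (by positivity)]; nlinarith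
      nlinarith
    have h5 := hb.trans (mul_le_mul_of_nonneg_left (add_le_add_right hlg 1) hC)
    have h6 : proximity f ⊤ r ≤ D + 2 * C * Real.log (r + 4) := by
      rw [hD]; nlinarith
    have h7 : 2 * C ≤ D := by
      rw [hD]
      have : 0 ≤ C * (1 + Real.log 2) + 2 * C * Real.log (4 * C + 1) := by positivity
      linarith
    nlinarith
  have hD0 : 0 ≤ D := by rw [hD]; positivity
  refine exists_polynomial_of_frequently_bound hf (C := Real.exp (3 * D) * 4 ^ ⌈3 * D⌉₊)
    (p := ⌈3 * D⌉₊) fun R₀ => ?_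
  obtain ⟨r, hr, hr5, hb⟩ := hDT (2 * R₀)
  refine ⟨r / 2, by linarith, fun z hz => ?_⟩
  have h1 := log_norm_le_proximity hf h0 (by linarith) (by linarith : r / 2 < r) hz
  rw [show (r + r / 2) / (r - r / 2) = 3 by field_simp; norm_num] at h1
  rcases eq_or_ne (f z) 0 with h2 | h2
  · rw [h2, norm_zero]; positivity
  have h3 : Real.log ‖f z‖ ≤ 3 * D + ⌈3 * D⌉₊ * Real.log (r + 4) := by
    have h4 := Nat.le_ceil (3 * D)
    have h5 : 0 ≤ Real.log (r + 4) := Real.log_nonneg (by linarith)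
    have h6 : Real.log ‖f z‖ ≤ log⁺ ‖f z‖ := le_max_right _ _
    nlinarith
  rw [Real.log_le_iff_le_exp (norm_pos_iff.2 h2), Real.exp_add, Real.exp_nat_mul,
    Real.exp_log (by linarith)] at h3
  refine h3.trans ?_
  rw [mul_assoc, ← mul_pow]
  gcongr
  linarith

/-- Two continuous functions which agree off the zeros of an entire function are equal. -/
lemma eq_of_eq_of_ne_zero {D g h : ℂ → ℂ} (hD : Differentiable ℂ D) {z₀ : ℂ} (h0 : D z₀ ≠ 0)
    (hg : Continuous g) (hh : Continuous h) (H : ∀ z, D z ≠ 0 → g z = h z) (z : ℂ) :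
    g z = h z := by
  have hev : ∀ᶠ w in 𝓝[≠] z, D w ≠ 0 := by
    by_contra hcon
    have hfr : ∃ᶠ w in 𝓝[≠] z, D w = 0 := hcon
    have := AnalyticOnNhd.eq_of_frequently_eq (f := D) (g := fun _ => 0)
      (fun w _ => hD.analyticAt w) (fun w _ => analyticAt_const) hfr
    exact h0 (congrFun this z₀)
  have h1 : Tendsto g (𝓝[≠] z) (𝓝 (g z)) := hg.continuousAt.mono_left nhdsWithin_le_nhds
  have h2 : Tendsto h (𝓝[≠] z) (𝓝 (h z)) := hh.continuousAt.mono_left nhdsWithin_le_nhds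
  exact tendsto_nhds_unique (h1.congr' (hev.mono H)) h2

/-- Divisibility of entire functions. -/
lemma exists_eq_mul_of_analyticOrderAt_le {D W : ℂ → ℂ} (hD : Differentiable ℂ D)
    (hW : Differentiable ℂ W) {z₀ : ℂ} (h0 : D z₀ ≠ 0)
    (h : ∀ z, analyticOrderAt D z ≤ analyticOrderAt W z) :
    ∃ ψ : ℂ → ℂ, Differentiable ℂ ψ ∧ ∀ z, W z = D z * ψ z := by
  have hm : MeromorphicOn (fun z => W z / D z) Set.univ := fun z _ =>
    (hW.analyticAt z).meromorphicAt.div (hD.analyticAt z).meromorphicAt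
  set ψ := toMeromorphicNFOn (fun z => W z / D z) Set.univ
  have hψ : Differentiable ℂ ψ := by
    intro z
    refine AnalyticAt.differentiableAt ?_
    rw [← (meromorphicNFOn_toMeromorphicNFOn _ _
      (Set.mem_univ z)).meromorphicOrderAt_nonneg_iff_analyticAt,
      meromorphicOrderAt_toMeromorphicNFOn hm (Set.mem_univ z)]
    have hDz : analyticOrderAt D z ≠ ⊤ := by
      intro hcon
      rw [analyticOrderAt_eq_top] at hcon
      have := AnalyticOnNhd.eq_of_eventuallyEq (f := D) (g := fun _ => 0)
        (fun w _ => hD.analyticAt w) (fun w _ => analyticAt_const) hcon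
      exact h0 (congrFun this z₀)
    rw [fun_meromorphicOrderAt_div (hW.analyticAt z).meromorphicAt (hD.analyticAt z).meromorphicAt,
      (hW.analyticAt z).meromorphicOrderAt_eq, (hD.analyticAt z).meromorphicOrderAt_eq]
    have hz := h z
    lift analyticOrderAt D z to ℕ using hDz with d
    generalize analyticOrderAt W z = w at hz
    induction w using ENat.recTopCoe with
    | top => simp [sub_eq_add_neg]
    | coe w =>
      have : (d : ℤ) ≤ w := by exact_mod_cast hz
      simp only [ENat.map_natCast]
      norm_cast
      rw [Int.subNatNat_eq_coe]
      omega
  refine ⟨ψ, hψ, fun z => ?_⟩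
  refine eq_of_eq_of_ne_zero hD h0 hW.continuous (hD.mul hψ).continuous (fun w hw => ?_) z
  have hev := hm.toMeromorphicNFOn_eq_self_on_nhdsNE (Set.mem_univ w)
  have hq : ContinuousAt (fun z => W z / D z) w :=
    hW.continuous.continuousAt.div hD.continuous.continuousAt hw
  have h1 : W w / D w = ψ w := tendsto_nhds_unique
    ((hq.tendsto.mono_left nhdsWithin_le_nhds).congr' hev.symm)
    (hψ.continuous.continuousAt.mono_left nhdsWithin_le_nhds)
  rw [Pi.mul_apply, ← h1, mul_div_cancel₀ _ hw]

lemma Polynomial.dvd_of_eval_mul_eq {h : ℂ → ℂ} (hh : Continuous h) (P : Polynomial ℂ) :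
    ∀ Q : Polynomial ℂ, P ≠ 0 → (∀ z, P.eval z * h z = Q.eval z) → P ∣ Q := by
  induction hd : P.natDegree generalizing P with
  | zero =>
    intro Q hP _
    exact (Polynomial.isUnit_iff_degree_eq_zero.2 (by
      rw [Polynomial.degree_eq_natDegree hP, hd]; rfl)).dvd
  | succ d ih =>
    intro Q hP hPQ
    obtain ⟨a, ha⟩ := IsAlgClosed.exists_root P (by
      rw [Polynomial.degree_eq_natDegree hP, hd]; exact_mod_cast d.succ_ne_zero)
    have hQa : Q.IsRoot a := by
      rw [Polynomial.IsRoot, ← hPQ, ha.eq_zero, zero_mul]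
    obtain ⟨P', rfl⟩ := Polynomial.dvd_iff_isRoot.2 ha
    obtain ⟨Q', rfl⟩ := Polynomial.dvd_iff_isRoot.2 hQa
    have hP' : P' ≠ 0 := right_ne_zero_of_mul hP
    refine mul_dvd_mul_left _ (ih P' ?_ Q' hP' fun z => ?_)
    · rw [Polynomial.natDegree_mul (Polynomial.X_sub_C_ne_zero a) hP',
        Polynomial.natDegree_X_sub_C] at hd
      omega
    · refine eq_of_eq_of_ne_zero (D := fun z => z - a) (z₀ := a + 1) (by fun_prop) (by simp)
        (P'.continuous.mul hh) Q'.continuous (fun w hw => ?_) z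
      have := hPQ w
      simp only [Polynomial.eval_mul, Polynomial.eval_sub, Polynomial.eval_X, Polynomial.eval_C,
        mul_assoc] at this
      exact mul_left_cancel₀ hw this

lemma exists_iteratedDeriv_pow_eq {f : ℂ → ℂ} (hf : Differentiable ℂ f) (l j : ℕ) :
    ∃ P : ℂ → ℂ, Differentiable ℂ P ∧
      ∀ z, iteratedDeriv j (fun z => f z ^ (l + j)) z = f z ^ l * P z := by
  suffices H : ∀ i ≤ j, ∃ P : ℂ → ℂ, Differentiable ℂ P ∧
      ∀ z, iteratedDeriv i (fun z => f z ^ (l + j)) z = f z ^ (l + (j - i)) * P z by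
    simpa using H j le_rfl
  intro i
  induction i with
  | zero => exact fun _ => ⟨fun _ => 1, by fun_prop, by simp⟩
  | succ i ih =>
    intro hi
    obtain ⟨P, hP, h⟩ := ih (by omega)
    refine ⟨fun z => (l + (j - (i + 1)) + 1 : ℕ) * deriv f z * P z + f z * deriv P z,
      ((hf.deriv.const_mul _).mul hP).add (hf.mul hP.deriv), fun z => ?_⟩
    rw [iteratedDeriv_succ, funext h, deriv_fun_mul ((hf z).fun_pow _) (hP z), deriv_fun_pow (hf z),
      show l + (j - i) = l + (j - (i + 1)) + 1 by omega]
    simp only [Nat.add_sub_cancel]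
    ring

/-- The auxiliary entire function attached to `f ^ n = 1 → (f ^ n)^(k) = 1`. -/
lemma exists_auxiliary_function {f : ℂ → ℂ} (hf : Differentiable ℂ f) {n k : ℕ} (hn : k + 2 ≤ n)
    (hshare : ∀ z, f z ^ n = 1 → iteratedDeriv k (fun z => f z ^ n) z = 1)
    {z₀ : ℂ} (h1 : f z₀ ^ n - 1 ≠ 0) :
    ∃ ψ : ℂ → ℂ, Differentiable ℂ ψ ∧ ∀ z, f z * ψ z * (f z ^ n - 1) * f z ^ n =
      deriv (fun z => f z ^ n) z * (iteratedDeriv k (fun z => f z ^ n) z - f z ^ n) := by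
  obtain ⟨l, rfl⟩ : ∃ l, n = l + 2 + k := ⟨n - (k + 2), by omega⟩
  obtain ⟨P, hP, hPeq⟩ := exists_iteratedDeriv_pow_eq hf (l + 2) k
  have hder : ∀ z, deriv (fun z => f z ^ (l + 2 + k)) z =
      ((l + 2 + k : ℕ) * f z ^ (l + 1 + k)) * deriv f z := by
    intro z
    rw [deriv_fun_pow (hf z), show l + 2 + k - 1 = l + 1 + k by omega]
  have hPk : Differentiable ℂ fun z => P z - f z ^ k := hP.sub (hf.fun_pow k)
  have hlk : Differentiable ℂ fun z => ((l + 2 + k : ℕ) : ℂ) * f z ^ l :=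
    (hf.fun_pow l).const_mul _
  obtain ⟨ψ, hψ, h⟩ := exists_eq_mul_of_analyticOrderAt_le
    (D := fun z => f z ^ (l + 2 + k) - 1)
    (W := (fun z => ((l + 2 + k : ℕ) : ℂ) * f z ^ l) * deriv f * fun z => P z - f z ^ k)
    ((hf.fun_pow _).sub_const 1) ((hlk.mul hf.deriv).mul hPk) h1 fun z => by
      by_cases hz : f z ^ (l + 2 + k) = 1
      · have hfz : f z ≠ 0 := by
          intro h0
          rw [h0, zero_pow (by omega)] at hz
          exact zero_ne_one hz
        have e1 := ((hf.fun_pow (l + 2 + k)).analyticAt z).analyticOrderAt_deriv_add_one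
        rw [hz, show deriv (fun z => f z ^ (l + 2 + k)) =
          (fun z => ((l + 2 + k : ℕ) * f z ^ (l + 1 + k) : ℂ)) * deriv f from funext hder,
          analyticOrderAt_mul (((hf.fun_pow _).const_mul _).analyticAt z) (hf.deriv.analyticAt z),
          (((hf.fun_pow _).const_mul _).analyticAt z).analyticOrderAt_eq_zero.2
            (mul_ne_zero (by exact_mod_cast (by omega)) (pow_ne_zero _ hfz)), zero_add] at e1
        rw [← e1, analyticOrderAt_mul ((hlk.mul hf.deriv).analyticAt z) (hPk.analyticAt z),
          analyticOrderAt_mul (hlk.analyticAt z) (hf.deriv.analyticAt z)]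
        refine add_le_add le_add_self ?_
        rw [Order.one_le_iff_ne_zero, (hPk.analyticAt z).analyticOrderAt_ne_zero]
        have e2 := hPeq z
        rw [hshare z hz, ← hz, pow_add] at e2
        rw [mul_left_cancel₀ (pow_ne_zero _ hfz) e2, sub_self]
      · rw [(((hf.fun_pow _).sub_const 1).analyticAt z).analyticOrderAt_eq_zero.2
          (sub_ne_zero.2 hz)]
        exact zero_le
  refine ⟨ψ, hψ, fun z => ?_⟩
  have hz := h z
  simp only [Pi.mul_apply] at hz
  rw [hder, hPeq]
  calc _ = f z * f z ^ (l + 2 + k) * ((f z ^ (l + 2 + k) - 1) * ψ z) := by ring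
    _ = _ := by rw [← hz]; ring

lemma Polynomial.eval_iteratedDeriv (P : Polynomial ℂ) (k : ℕ) :
    iteratedDeriv k (fun z => P.eval z) = fun z => (Polynomial.derivative^[k] P).eval z := by
  induction k with
  | zero => simp
  | succ k ih =>
    rw [iteratedDeriv_succ, ih, Function.iterate_succ_apply']
    ext z
    exact Polynomial.deriv _

lemma Polynomial.not_differential_equation {P : Polynomial ℂ} {φ : ℂ → ℂ} (hφ : Continuous φ)
    {n k : ℕ}
    (heq : ∀ z, φ z * (P.eval z ^ n - 1) * P.eval z ^ n = deriv (fun z => P.eval z ^ n) z *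
      (iteratedDeriv k (fun z => P.eval z ^ n) z - P.eval z ^ n)) {z₀ : ℂ}
    (h1 : deriv (fun z => P.eval z ^ n) z₀ ≠ 0) :
    iteratedDeriv k (fun z => P.eval z ^ n) z₀ = P.eval z₀ ^ n := by
  by_contra h2
  set F := P ^ n with hF
  have hFe : (fun z => P.eval z ^ n) = fun z => F.eval z := by simp [hF]
  have hFz : ∀ z, P.eval z ^ n = F.eval z := by simp [hF]
  rw [hFe, Polynomial.deriv] at h1
  rw [hFe, Polynomial.eval_iteratedDeriv, hFz] at h2
  have hd : 0 < F.natDegree := by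
    by_contra! hd
    rw [Polynomial.eq_C_of_natDegree_le_zero hd] at h1
    simp at h1
  have hF0 : F ≠ 0 := by rintro h; simp [h] at hd
  have hF1 : (F - 1).natDegree = F.natDegree := by
    simpa using Polynomial.natDegree_sub_C (p := F) (a := 1)
  have hF10 : F - 1 ≠ 0 := by rintro h; simp [h] at hF1; omega
  have hQ1 : F.derivative ≠ 0 := by rintro h; simp [h] at h1
  have hQ2 : Polynomial.derivative^[k] F - F ≠ 0 := by
    intro h
    rw [sub_eq_zero] at h
    rw [h] at h2; exact h2 rfl
  have hdvd : (F - 1) * F ∣ F.derivative * (Polynomial.derivative^[k] F - F) := by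
    refine Polynomial.dvd_of_eval_mul_eq hφ _ _ (mul_ne_zero hF10 hF0) fun z => ?_
    have := heq z
    rw [hFe, Polynomial.eval_iteratedDeriv, hFz, Polynomial.deriv] at this
    simp only [Polynomial.eval_mul, Polynomial.eval_sub, Polynomial.eval_one]
    rw [← this]; ring
  have hle := Polynomial.natDegree_le_of_dvd hdvd (mul_ne_zero hQ1 hQ2)
  rw [Polynomial.natDegree_mul hF10 hF0, Polynomial.natDegree_mul hQ1 hQ2, hF1] at hle
  have h3 := Polynomial.natDegree_derivative_lt (p := F) hd.ne'
  have h4 : (Polynomial.derivative^[k] F - F).natDegree ≤ F.natDegree :=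
    (Polynomial.natDegree_sub_le _ _).trans (max_le
      ((Polynomial.natDegree_iterate_derivative F k).trans (Nat.sub_le _ _)) le_rfl)
  omega

/-- If the `k`-th derivative of `f ^ n` takes the value `1` wherever `f ^ n` does, then `f ^ n`
equals its `k`-th derivative. -/
theorem iteratedDeriv_pow_eq_self {f : ℂ → ℂ} (hf : Differentiable ℂ f) {n k : ℕ} (hk : 1 ≤ k)
    (hn : k + 2 ≤ n) (hshare : ∀ z, f z ^ n = 1 → iteratedDeriv k (fun z => f z ^ n) z = 1)
    {z₀ : ℂ} (h0 : iteratedDeriv k (fun z => f z ^ n) z₀ ≠ 0) (z : ℂ) :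
    iteratedDeriv k (fun z => f z ^ n) z = f z ^ n := by
  have hF : Differentiable ℂ fun z => f z ^ n := hf.fun_pow n
  have hjk : ∀ j ≤ k, ∃ z, iteratedDeriv j (fun z => f z ^ n) z ≠ 0 := by
    intro j hj
    by_contra! h
    obtain ⟨i, rfl⟩ := Nat.exists_eq_add_of_le' hj
    rw [iteratedDeriv_eq_iterate, Function.iterate_add_apply, ← iteratedDeriv_eq_iterate,
      ← iteratedDeriv_eq_iterate, show iteratedDeriv j (fun z => f z ^ n) = fun _ => 0 from funext h] at h0
    simp at h0
  obtain ⟨z₁, hz₁⟩ := hjk 1 hk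
  rw [iteratedDeriv_one] at hz₁
  obtain ⟨z₂, hz₂⟩ : ∃ z, f z ^ n - 1 ≠ 0 := by
    by_contra! h
    rw [show (fun z => f z ^ n) = fun _ => 1 from funext fun z => sub_eq_zero.1 (h z)] at hz₁
    simp at hz₁
  obtain ⟨z₃, hz₃⟩ := hjk 0 (Nat.zero_le k)
  replace hz₃ : f z₃ ≠ 0 := by
    rintro h
    rw [iteratedDeriv_zero, h, zero_pow (by omega)] at hz₃
    exact hz₃ rfl
  obtain ⟨ψ, hψ, hode⟩ := exists_auxiliary_function hf hn hshare hz₂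
  by_contra hne
  have hE : Differentiable ℂ fun z => iteratedDeriv k (fun z => f z ^ n) z - f z ^ n :=
    (hF.iteratedDeriv_complex k).sub hF
  have hcod : ∀ᶠ z in codiscrete ℂ, f z ≠ 0 ∧ f z ^ n - 1 ≠ 0 ∧ deriv (fun z => f z ^ n) z ≠ 0 ∧
      iteratedDeriv k (fun z => f z ^ n) z - f z ^ n ≠ 0 ∧
      ∀ j ∈ Finset.range k, iteratedDeriv j (fun z => f z ^ n) z ≠ 0 := by
    refine (hf.eventually_ne_zero hz₃).and (((hF.sub_const 1).eventually_ne_zero hz₂).and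
      ((hF.deriv.eventually_ne_zero hz₁).and ((hE.eventually_ne_zero (sub_ne_zero.2 hne)).and
      ((Finset.range k).eventually_all.2 fun j hj => ?_))))
    obtain ⟨w, hw⟩ := hjk j (Finset.mem_range.1 hj).le
    exact (hF.iteratedDeriv_complex j).eventually_ne_zero hw
  obtain ⟨a, ha0, ha1, had, haE, haj⟩ := Eventually.exists (f := 𝓝[≠] (0 : ℂ)) (by
    have := mem_codiscreteWithin_iff_forall_mem_nhdsNE.1 hcod 0 (Set.mem_univ _)
    rwa [Set.compl_univ, Set.union_empty] at this)
  have hψa : ψ a ≠ 0 := by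
    intro h
    have := hode a
    rw [h, mul_zero, zero_mul, zero_mul] at this
    exact mul_ne_zero had haE this.symm
  have htr : ∀ j z, iteratedDeriv j (fun z => f (z + a) ^ n) z =
      iteratedDeriv j (fun z => f z ^ n) (z + a) := fun j z =>
    congrFun (iteratedDeriv_comp_add_const j (fun z => f z ^ n) a) z
  have hg : Differentiable ℂ fun z => f (z + a) := by fun_prop
  obtain ⟨Q, hQ⟩ := IsSmallError.exists_polynomial hg (by simpa using ha0)
    (isSmallError_proximity_of_differential_equation hg (ψ := fun z => ψ (z + a)) (by fun_prop)
      (n := n) (k := k) (by omega)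
      (fun z => by
        rw [htr, ← iteratedDeriv_one, htr, iteratedDeriv_one]
        exact hode (z + a))
      (by simpa using ha0) (by simpa using hψa) (by simpa using ha1)
      (fun j hj => by
        rw [htr, zero_add]
        exact haj j (Finset.mem_range.2 hj)))
  have hfP : f = fun z => (Q.comp (Polynomial.X - Polynomial.C a)).eval z := by
    ext z
    have := hQ (z - a)
    simpa using this
  have hlast := Polynomial.not_differential_equation (P := Q.comp (Polynomial.X - Polynomial.C a))
    (φ := fun z => f z * ψ z) (hf.continuous.mul hψ.continuous) (n := n) (k := k) (z₀ := a)
  simp only [← congrFun hfP] at hlast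
  exact haE (sub_eq_zero.2 (hlast hode had))

lemma exists_norm_le_mul_exp {F : ℂ → ℂ} (hF : Differentiable ℂ F) {k : ℕ} (hk : 1 ≤ k)
    (h : iteratedDeriv k F = F) : ∃ B : ℝ, 0 < B ∧ ∀ z, ‖F z‖ ≤ B * Real.exp ‖z‖ := by
  set B : ℝ := 1 + ∑ j ∈ Finset.range k, ‖iteratedDeriv j F 0‖ with hB
  have hB0 : 0 < B := by positivity
  have hle : ∀ j, ‖iteratedDeriv j F 0‖ ≤ B := by
    intro j
    induction j using Nat.strong_induction_on with
    | _ j ih =>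
      rcases lt_or_ge j k with hj | hj
      · have := Finset.single_le_sum (f := fun j => ‖iteratedDeriv j F 0‖)
          (fun _ _ => norm_nonneg _) (Finset.mem_range.2 hj)
        linarith
      · obtain ⟨i, rfl⟩ := Nat.exists_eq_add_of_le' hj
        rw [iteratedDeriv_eq_iterate, Function.iterate_add_apply, ← iteratedDeriv_eq_iterate,
          ← iteratedDeriv_eq_iterate, h]
        exact ih i (by omega)
  refine ⟨B, hB0, fun z => ?_⟩
  have h1 := (NormedSpace.expSeries_div_hasSum_exp ‖z‖).mul_left B
  rw [← Real.exp_eq_exp_ℝ] at h1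
  rw [← (hasSum_taylorSeries_of_entire hF 0 z).tsum_eq]
  refine tsum_of_norm_bounded h1 fun j => ?_
  rw [norm_smul, norm_smul, norm_inv, norm_pow, sub_zero, Complex.norm_natCast, mul_div_assoc',
    inv_mul_eq_div, mul_comm B]
  gcongr
  exact hle j

/-- A zero-free entire function of exponential type is an exponential. -/
lemma exists_deriv_eq_mul_of_norm_le_mul_exp {F : ℂ → ℂ} (hF : Differentiable ℂ F)
    (hne : ∀ z, F z ≠ 0) {B : ℝ} (hB0 : 0 < B) (hB : ∀ z, ‖F z‖ ≤ B * Real.exp ‖z‖) :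
    ∃ a : ℂ, ∀ z, deriv F z = a * F z := by
  have hq : Differentiable ℂ fun z => deriv F z / F z := hF.deriv.div hF hne
  obtain ⟨L, hL0, hL⟩ := hq.isExactOn_univ.with_val_at 0 0
  have hLd : Differentiable ℂ L := fun z => (hL z (Set.mem_univ z)).differentiableAt
  have hLderiv : ∀ z, deriv L z = deriv F z / F z := fun z => (hL z (Set.mem_univ z)).deriv
  set C : ℝ := |Real.log (B / ‖F 0‖)| + 1
  have hC : 1 ≤ C := le_add_of_nonneg_left (abs_nonneg _)
  have hF0 : 0 < ‖F 0‖ := norm_pos_iff.2 (hne 0)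
  have hre : ∀ z, (L z).re ≤ C + ‖z‖ := by
    intro z
    have h1 := re_eq_log_of_eq_mul_exp (hne 0) (eq_mul_exp_of_hasDerivAt_logDeriv hF
      (R := ‖z‖ + 1) (fun w _ => hne w) hL0 (fun w _ => hL w (Set.mem_univ w))
      (by simp : z ∈ ball (0 : ℂ) (‖z‖ + 1)))
    have h2 : ‖F z‖ / ‖F 0‖ ≤ B / ‖F 0‖ * Real.exp ‖z‖ := by
      rw [div_mul_eq_mul_div]
      gcongr
      exact hB z
    have h3 := Real.log_le_log (div_pos (norm_pos_iff.2 (hne z)) hF0) h2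
    rw [Real.log_mul (by positivity) (by positivity), Real.log_exp] at h3
    rw [h1]
    linarith [le_abs_self (Real.log (B / ‖F 0‖))]
  have hLn : ∀ R : ℝ, 1 ≤ R → ∀ z : ℂ, ‖z‖ ≤ R → ‖L z‖ ≤ 2 * (C + 2 * R) := by
    intro R hR z hz
    have hM : 0 < C + 2 * R := by linarith
    have h1 := borelCaratheodory_zero hM (R := 2 * R) (z := z) hLd.differentiableOn
      (fun w hw => by
        rw [mem_ball_zero_iff] at hw
        exact (hre w).trans (by linarith)) (by linarith)
      (by rw [mem_ball_zero_iff]; linarith) hL0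
    refine h1.trans ?_
    rw [div_le_iff₀ (by linarith)]
    nlinarith
  have hbd : ∀ z, ‖deriv L z‖ ≤ 2 * C + 8 := by
    intro z
    have hR : 1 ≤ ‖z‖ + 1 := le_add_of_nonneg_left (norm_nonneg z)
    have h1 := norm_deriv_le_of_forall_mem_sphere_norm_le (by linarith : 0 < ‖z‖ + 1)
      hLd.diffContOnCl (c := z) (C := 2 * (C + 2 * (2 * (‖z‖ + 1)))) fun w hw => by
        refine hLn _ (by linarith) w ?_
        rw [mem_sphere_iff_norm] at hw
        have := norm_add_le (w - z) z
        rw [sub_add_cancel, hw] at this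
        linarith
    refine h1.trans ?_
    rw [div_le_iff₀ (by linarith)]
    nlinarith
  refine ⟨deriv L 0, fun z => ?_⟩
  have := hLd.deriv.apply_eq_apply_of_bounded
    ((isBounded_iff_forall_norm_le).2 ⟨2 * C + 8, by rintro _ ⟨z, rfl⟩; exact hbd z⟩) 0 z
  rw [this, hLderiv, div_mul_cancel₀ _ (hne z)]

/-- An entire function `f` whose power `f ^ n` equals its own `k`-th derivative is an
exponential. -/
theorem exists_deriv_eq_of_iteratedDeriv_pow_eq_self {f : ℂ → ℂ} (hf : Differentiable ℂ f)
    {n k : ℕ} (hk : 1 ≤ k) (hn : k ≤ n)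
    (h : ∀ z, iteratedDeriv k (fun z => f z ^ n) z = f z ^ n) {z₀ : ℂ} (h0 : f z₀ ≠ 0) :
    ∃ a : ℂ, a ^ k = 1 ∧ ∀ z, f z ≠ 0 ∧ n * deriv f z = a * f z := by
  have hF : Differentiable ℂ fun z => f z ^ n := hf.fun_pow n
  have hne : ∀ z, f z ≠ 0 := by
    intro z hz
    have hj : ∀ j, iteratedDeriv j (fun z => f z ^ n) z = 0 := by
      intro j
      induction j using Nat.strong_induction_on with
      | _ j ih =>
        rcases lt_or_ge j k with hj | hj
        · obtain ⟨l, rfl⟩ : ∃ l, n = l + j := ⟨n - j, by omega⟩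
          obtain ⟨P, -, hP⟩ := exists_iteratedDeriv_pow_eq hf l j
          rw [hP, hz, zero_pow (by omega), zero_mul]
        · obtain ⟨i, rfl⟩ := Nat.exists_eq_add_of_le' hj
          rw [iteratedDeriv_eq_iterate, Function.iterate_add_apply, ← iteratedDeriv_eq_iterate,
            ← iteratedDeriv_eq_iterate, funext h]
          exact ih i (by omega)
    have := (hasSum_taylorSeries_of_entire hF z z₀).tsum_eq
    simp only [hj, smul_zero, tsum_zero] at this
    exact pow_ne_zero n h0 this.symm
  obtain ⟨B, hB0, hB⟩ := exists_norm_le_mul_exp hF hk (funext h)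
  obtain ⟨a, ha⟩ := exists_deriv_eq_mul_of_norm_le_mul_exp hF (fun z => pow_ne_zero n (hne z))
    hB0 hB
  have hiter : ∀ j, iteratedDeriv j (fun z => f z ^ n) = fun z => a ^ j * f z ^ n := by
    intro j
    induction j with
    | zero => simp
    | succ j ih =>
      rw [iteratedDeriv_succ, ih]
      ext z
      rw [deriv_const_mul _ (hF z), ha]
      ring
  refine ⟨a, ?_, fun z => ⟨hne z, ?_⟩⟩
  · have := h z₀
    rw [hiter] at this
    exact mul_right_cancel₀ (pow_ne_zero n h0) (this.trans (one_mul _).symm)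
  · have := ha z
    obtain ⟨l, rfl⟩ : ∃ l, n = l + 1 := ⟨n - 1, by omega⟩
    rw [deriv_fun_pow (hf z), Nat.add_sub_cancel, pow_succ] at this
    exact mul_left_cancel₀ (pow_ne_zero l (hne z)) (by linear_combination this)

section several

variable {m : ℕ} {f : (Fin m → ℂ) → ℂ}

lemma exists_norm_fderiv_le (hf : Differentiable ℂ f) (z₀ : Fin m → ℂ) (r : ℝ) :
    ∃ M : ℝ, ∀ z ∈ ball z₀ r, ‖fderiv ℂ f z‖ ≤ M := by
  obtain ⟨M, hM⟩ := (isCompact_closedBall z₀ (r + 1)).exists_bound_of_continuousOn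
    hf.continuous.continuousOn
  refine ⟨2 * M / 1, fun z hz => ?_⟩
  refine Complex.norm_fderiv_le_div_of_mapsTo_ball hf.differentiableOn (fun w hw => ?_) one_pos
  rw [mem_ball] at hz hw
  rw [mem_closedBall, dist_eq_norm, two_mul]
  refine (norm_sub_le _ _).trans (add_le_add (hM w ?_) (hM z ?_)) <;> rw [mem_closedBall]
  · linarith [dist_triangle w z z₀]
  · linarith

lemma hasDerivAt_comp_line (hf : Differentiable ℂ f) (u z : Fin m → ℂ) (t : ℂ) :
    HasDerivAt (fun s : ℂ => f (z + s • u)) (dirDeriv u f (z + t • u)) t := by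
  have h1 : HasDerivAt (fun s : ℂ => z + s • u) u t := by
    simpa using ((hasDerivAt_id t).smul_const u).const_add z
  exact (hf (z + t • u)).hasFDerivAt.comp_hasDerivAt t h1

lemma dirDeriv_eq_circleIntegral (hf : Differentiable ℂ f) (u z : Fin m → ℂ) :
    dirDeriv u f z = (2 * π * I : ℂ)⁻¹ * ∫ θ in (0 : ℝ)..2 * π,
      (deriv (circleMap 0 1) θ * (circleMap 0 1 θ ^ 2)⁻¹) • f (z + circleMap 0 1 θ • u) := by
  have hd : Differentiable ℂ fun s : ℂ => f (z + s • u) := fun t =>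
    (hasDerivAt_comp_line hf u z t).differentiableAt
  have := two_pi_I_inv_smul_circleIntegral_sub_sq_inv_smul_of_differentiable isOpen_univ
    (Set.subset_univ (closedBall (0 : ℂ) 1)) hd.differentiableOn (mem_ball_self one_pos)
  rw [(hasDerivAt_comp_line hf u z 0).deriv, zero_smul, add_zero] at this
  rw [← this, circleIntegral]
  simp only [sub_zero, smul_eq_mul, mul_assoc]

/-- The directional derivatives of an entire function of several variables are entire. -/
theorem differentiable_dirDeriv (hf : Differentiable ℂ f) (u : Fin m → ℂ) :
    Differentiable ℂ (dirDeriv u f) := by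
  rw [funext (dirDeriv_eq_circleIntegral hf u)]
  intro z₀
  refine DifferentiableAt.const_mul ?_ _
  set c : ℝ → ℂ := fun θ => deriv (circleMap 0 1) θ * (circleMap 0 1 θ ^ 2)⁻¹ with hc
  have hcn : ∀ θ, ‖c θ‖ = 1 := fun θ => by simp [hc]
  have hcc : Continuous c := by
    simp only [hc, deriv_circleMap]
    have : Continuous (circleMap 0 1) := continuous_circleMap 0 1
    refine Continuous.mul (by fun_prop) (Continuous.inv₀ (by fun_prop) fun θ => ?_)
    exact pow_ne_zero 2 (circleMap_ne_center one_ne_zero)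
  have hl : ∀ z : Fin m → ℂ, Continuous fun θ : ℝ => z + circleMap 0 1 θ • u := fun z => by
    have : Continuous (circleMap 0 1) := continuous_circleMap 0 1
    fun_prop
  obtain ⟨M, hM⟩ := exists_norm_fderiv_le hf z₀ (1 + ‖u‖)
  refine (intervalIntegral.hasFDerivAt_integral_of_dominated_of_fderiv_le
    (F := fun z θ => c θ • f (z + circleMap 0 1 θ • u))
    (F' := fun z θ => c θ • fderiv ℂ f (z + circleMap 0 1 θ • u)) (bound := fun _ => M)
    (ball_mem_nhds z₀ one_pos) ?_ ?_ ?_ ?_ ?_ ?_).differentiableAt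
  · exact Eventually.of_forall fun z =>
      (hcc.smul (hf.continuous.comp (hl z))).aestronglyMeasurable
  · exact (hcc.smul (hf.continuous.comp (hl z₀))).intervalIntegrable _ _
  · refine hcc.aestronglyMeasurable.smul (Measurable.aestronglyMeasurable ?_)
    exact (measurable_fderiv ℂ f).comp (hl z₀).measurable
  · refine Eventually.of_forall fun θ _ z hz => ?_
    rw [norm_smul, hcn, one_mul]
    refine hM _ ?_
    rw [mem_ball, dist_eq_norm] at hz ⊢
    calc ‖z + circleMap 0 1 θ • u - z₀‖ = ‖(z - z₀) + circleMap 0 1 θ • u‖ := by congr 1; abel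
      _ ≤ ‖z - z₀‖ + ‖circleMap 0 1 θ • u‖ := norm_add_le _ _
      _ < 1 + ‖u‖ := by
        rw [norm_smul]
        simp only [norm_circleMap_zero, abs_one, one_mul]
        linarith
  · exact intervalIntegrable_const
  · refine Eventually.of_forall fun θ _ z _ => ?_
    have := (hasFDerivAt_comp_add_right (circleMap 0 1 θ • u)).2
      (hf (z + circleMap 0 1 θ • u)).hasFDerivAt
    exact this.const_smul (c θ)

lemma differentiable_iterate_dirDeriv (hf : Differentiable ℂ f) (u : Fin m → ℂ) (k : ℕ) :
    Differentiable ℂ ((dirDeriv u)^[k] f) := by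
  induction k with
  | zero => exact hf
  | succ k ih => rw [Function.iterate_succ_apply']; exact differentiable_dirDeriv ih u

lemma iteratedDeriv_comp_line (hf : Differentiable ℂ f) (u z : Fin m → ℂ) (k : ℕ) :
    iteratedDeriv k (fun s : ℂ => f (z + s • u)) = fun t => (dirDeriv u)^[k] f (z + t • u) := by
  induction k with
  | zero => simp
  | succ k ih =>
    rw [iteratedDeriv_succ, ih, Function.iterate_succ_apply']
    exact funext fun t =>
      (hasDerivAt_comp_line (differentiable_iterate_dirDeriv hf u k) u z t).deriv

/-- Identity theorem for entire functions of several variables. -/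
lemma eq_zero_of_eventually_eq_zero (hf : Differentiable ℂ f) {z₀ : Fin m → ℂ}
    (h : ∀ᶠ z in 𝓝 z₀, f z = 0) (z : Fin m → ℂ) : f z = 0 := by
  have hd : Differentiable ℂ fun s : ℂ => f (z₀ + s • (z - z₀)) := fun t =>
    (hasDerivAt_comp_line hf (z - z₀) z₀ t).differentiableAt
  have hc : Tendsto (fun s : ℂ => z₀ + s • (z - z₀)) (𝓝 0) (𝓝 z₀) := by
    have : Continuous fun s : ℂ => z₀ + s • (z - z₀) := by fun_prop
    simpa using this.tendsto 0
  have := AnalyticOnNhd.eq_of_eventuallyEq (f := fun s : ℂ => f (z₀ + s • (z - z₀)))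
    (g := fun _ => 0) (fun w _ => hd.analyticAt w) (fun w _ => analyticAt_const)
    (hc.eventually h)
  simpa using congrFun this 1

/-- A continuous function at a point with values in a finite set near that point is locally
constant there. -/
lemma eventually_eq_of_finite {X Y : Type*} [TopologicalSpace X] [TopologicalSpace Y] [T1Space Y]
    {q : X → Y} {x : X} {S : Set Y} (hS : S.Finite) (hq : ContinuousAt q x)
    (h : ∀ᶠ y in 𝓝 x, q y ∈ S) : ∀ᶠ y in 𝓝 x, q y = q x := by
  have h1 : (S \ {q x})ᶜ ∈ 𝓝 (q x) := hS.sdiff.isClosed.isOpen_compl.mem_nhds (by simp)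
  filter_upwards [h, hq.eventually_mem h1] with y hy hy'
  by_contra hne
  exact hy' ⟨hy, hne⟩

end several

end

/-- Paper's Theorem 2.2. -/
theorem power_share_one_IM_entire
    (m : ℕ) (hm : 1 ≤ m) (f : (Fin m → ℂ) → ℂ)
    (hf : Differentiable ℂ f) (hnc : ¬∃ c : ℂ, ∀ z, f z = c)
    (u : Fin m → ℂ) (hu : ∑ j, Complex.normSq (u j) = 1)
    (k n : ℕ) (hk : 1 ≤ k) (hn : k + 2 ≤ n)
    (hne : ¬∀ z, (dirDeriv u)^[k] (fun w => f w ^ n) z = 0)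
    (hshare : ∀ z, f z ^ n = 1 ↔ (dirDeriv u)^[k] (fun w => f w ^ n) z = 1) :
    ∃ c : ℂ, c ≠ 0 ∧ (c / (n : ℂ)) ^ k = 1 ∧ ∀ z, f z = c * dirDeriv u f z := by
  have hF : Differentiable ℂ fun w => f w ^ n := hf.fun_pow n
  have hn0 : (n : ℂ) ≠ 0 := by exact_mod_cast (by omega)
  obtain ⟨z₀, hz₀⟩ := not_forall.1 hne
  have hline : ∀ z, (dirDeriv u)^[k] (fun w => f w ^ n) z ≠ 0 →
      dirDeriv u f z ≠ 0 ∧ (f z / dirDeriv u f z / n) ^ k = 1 := by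
    intro z hz
    have hg : Differentiable ℂ fun s : ℂ => f (z + s • u) := fun t =>
      (hasDerivAt_comp_line hf u z t).differentiableAt
    have hit := iteratedDeriv_comp_line hF u z k
    have hself := iteratedDeriv_pow_eq_self hg hk hn (fun t ht => by
      rw [hit]; exact (hshare _).1 ht) (z₀ := 0) (by rw [hit]; simpa using hz)
    have h0 : f z ≠ 0 := by
      intro h
      have := hself 0
      rw [hit] at this
      simp only [zero_smul, add_zero, h, zero_pow (by omega : n ≠ 0)] at this
      exact hz this
    obtain ⟨a, ha, h⟩ := exists_deriv_eq_of_iteratedDeriv_pow_eq_self hg hk (by omega) hself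
      (z₀ := 0) (by simpa using h0)
    have h2 := (h 0).2
    rw [(hasDerivAt_comp_line hf u z 0).deriv, zero_smul, add_zero] at h2
    have ha0 : a ≠ 0 := by
      rintro rfl
      rw [zero_pow (by omega)] at ha
      exact zero_ne_one ha
    have hd : dirDeriv u f z ≠ 0 := by
      intro h3
      rw [h3, mul_zero] at h2
      exact mul_ne_zero ha0 h0 h2.symm
    refine ⟨hd, ?_⟩
    rw [show f z / dirDeriv u f z / n = a⁻¹ by
      field_simp
      linear_combination -h2, inv_pow, ha, inv_one]
  have hev : ∀ᶠ z in nhds z₀, (dirDeriv u)^[k] (fun w => f w ^ n) z ≠ 0 :=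
    (differentiable_iterate_dirDeriv hF u k).continuous.continuousAt.eventually_ne hz₀
  obtain ⟨hd₀, hc₀⟩ := hline z₀ hz₀
  have hfin : {c : ℂ | (c / n) ^ k = 1}.Finite := by
    have : {w : ℂ | w ^ k = 1}.Finite := by
      refine (Polynomial.nthRoots k (1 : ℂ)).toFinset.finite_toSet.subset fun w hw => ?_
      simpa [Polynomial.mem_nthRoots hk] using hw
    exact this.preimage fun a _ b _ h => (div_left_inj' hn0).1 h
  have hD := differentiable_dirDeriv hf u
  have hconst := eventually_eq_of_finite (q := fun z => f z / dirDeriv u f z) hfin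
    (hf.continuous.continuousAt.div hD.continuous.continuousAt hd₀)
    (hev.mono fun z hz => (hline z hz).2)
  set c := f z₀ / dirDeriv u f z₀
  refine ⟨c, ?_, hc₀, fun z => ?_⟩
  · intro h
    rw [h, zero_div, zero_pow (by omega)] at hc₀
    exact zero_ne_one hc₀
  · refine sub_eq_zero.1 (eq_zero_of_eventually_eq_zero (f := fun z => f z - c * dirDeriv u f z)
      (z₀ := z₀) (hf.sub (hD.const_mul c)) ?_ z)
    filter_upwards [hev, hconst] with w hw hw'
    rw [← hw', div_mul_cancel₀ _ (hline w hw).1, sub_self]
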